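/- For every nondeterministic Streett word automaton S with n ≥ 1 states and k pairs there exists a deterministic parity word automaton D with at most 2·n^n·(k+1)^{n(k+1)}·(n(k+1))! states and parity index 2n(k+1) such that L(D) = L(S). -/

import Mathlib

/-- The set of states occurring infinitely often in an infinite sequence. -/
def InfOcc {S : Type} (r : ℕ → S) : Set S :=
  {s | ∀ N : ℕ, ∃ n, N ≤ n ∧ r n = s}

/-- `r` is a run of the nondeterministic automaton with transition function `δ`
and initial state `s0` on the infinite word `w`. -/
def IsRun {A S : Type} (δ : S → A → Set S) (s0 : S) (w : ℕ → A) (r : ℕ → S) : Prop :=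
  r 0 = s0 ∧ ∀ j, r (j + 1) ∈ δ (r j) (w j)

/-- The language of a nondeterministic Büchi word automaton:
some run visits the acceptance set `acc` infinitely often. -/
def BuchiLang {A S : Type} (δ : S → A → Set S) (s0 : S) (acc : Set S) : Set (ℕ → A) :=
  {w | ∃ r, IsRun δ s0 w r ∧ (InfOcc r ∩ acc).Nonempty}

/-- The language of a nondeterministic Streett word automaton with pairs
`⟨R i, G i⟩`: some run `r` satisfies, for every `i`,
`inf(r) ∩ G i = ∅` or `inf(r) ∩ R i ≠ ∅`. -/
def StreettLang {A S : Type} {k : ℕ} (δ : S → A → Set S) (s0 : S)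
    (R G : Fin k → Set S) : Set (ℕ → A) :=
  {w | ∃ r, IsRun δ s0 w r ∧ ∀ i, InfOcc r ∩ G i = ∅ ∨ (InfOcc r ∩ R i).Nonempty}

/-- The unique run of a deterministic automaton with transition function `δ`
and initial state `s0` on the infinite word `w`. -/
def DetRun {A S : Type} (δ : S → A → S) (s0 : S) (w : ℕ → A) : ℕ → S
  | 0 => s0
  | j + 1 => δ (DetRun δ s0 w j) (w j)

/-- `F` is a partition of the state space into `k` (possibly empty) classes. -/
def IsPartition {S : Type} {k : ℕ} (F : Fin k → Set S) : Prop :=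
  (∀ i j : Fin k, i ≠ j → F i ∩ F j = ∅) ∧ (⋃ i, F i) = Set.univ

/-- A run is accepted by the parity condition `F 0, …, F (k-1)` iff the least
`i` such that `inf(r) ∩ F i ≠ ∅` is even. -/
def ParityAccept {S : Type} {k : ℕ} (F : Fin k → Set S) (r : ℕ → S) : Prop :=
  ∃ i : Fin k, Even (i : ℕ) ∧ (InfOcc r ∩ F i).Nonempty ∧
    ∀ j : Fin k, j < i → InfOcc r ∩ F j = ∅

/-- A run is accepted by the Rabin condition with pairs `⟨E i, F i⟩` iff for
some `i`, `inf(r) ∩ E i = ∅` and `inf(r) ∩ F i ≠ ∅`. -/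
def RabinAccept {S : Type} {k : ℕ} (E F : Fin k → Set S) (r : ℕ → S) : Prop :=
  ∃ i : Fin k, InfOcc r ∩ E i = ∅ ∧ (InfOcc r ∩ F i).Nonempty

/-- König's lemma for a sequence of nonempty levels of a finite set. -/
theorem exists_path_of_levels {S : Type} [Finite S] (X : ℕ → Set S) (E : ℕ → S → S → Prop)
    (hne : ∀ t, (X t).Nonempty)
    (hpred : ∀ t, ∀ s' ∈ X (t + 1), ∃ s ∈ X t, E t s s') :
    ∃ r : ℕ → S, ∀ t, r t ∈ X t ∧ E t (r t) (r (t + 1)) := by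
  let _ : TopologicalSpace S := ⊥
  have _ : DiscreteTopology S := ⟨rfl⟩
  let K : ℕ → Set (ℕ → S) := fun n =>
    {r | (∀ i, i ≤ n → r i ∈ X i) ∧ ∀ i, i < n → E i (r i) (r (i + 1))}
  have hK : ∀ n, ∀ s ∈ X n, ∃ r ∈ K n, r n = s := by
    intro n
    induction n with
    | zero =>
      intro s hs
      refine ⟨fun _ => s, ⟨?_, ?_⟩, rfl⟩
      · intro i hi
        obtain rfl : i = 0 := by omega
        exact hs
      · intro i hi
        omega
    | succ n ih =>
      intro s hs
      obtain ⟨s', hs', hE⟩ := hpred n s hs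
      obtain ⟨r, ⟨h1, h2⟩, rfl⟩ := ih s' hs'
      refine ⟨Function.update r (n + 1) s, ⟨?_, ?_⟩, by simp⟩
      · intro i hi
        rcases Nat.lt_or_ge n i with h | h
        · obtain rfl : i = n + 1 := by omega
          simpa using hs
        · rw [Function.update_of_ne (by omega)]
          exact h1 i h
      · intro i hi
        rw [Function.update_of_ne (by omega : i ≠ n + 1)]
        rcases Nat.lt_or_ge i n with h | h
        · rw [Function.update_of_ne (by omega)]
          exact h2 i h
        · obtain rfl : i = n := by omega
          simpa using hE
  have hclosed : ∀ n, IsClosed (K n) := by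
    intro n
    have h1 : IsClosed {r : ℕ → S | ∀ i, i ≤ n → r i ∈ X i} := by
      simp only [Set.ofPred_forall]
      refine isClosed_iInter fun i => isClosed_iInter fun _ => ?_
      exact (isClosed_discrete (X i)).preimage (continuous_apply i)
    have h2 : IsClosed {r : ℕ → S | ∀ i, i < n → E i (r i) (r (i + 1))} := by
      simp only [Set.ofPred_forall]
      refine isClosed_iInter fun i => isClosed_iInter fun _ => ?_
      have hE : IsClosed {p : S × S | E i p.1 p.2} := isClosed_discrete _
      have hc : Continuous fun r : ℕ → S => (r i, r (i + 1)) :=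
        (continuous_apply i).prodMk (continuous_apply (i + 1))
      exact hE.preimage hc
    exact h1.inter h2
  obtain ⟨r, hr⟩ := IsCompact.nonempty_iInter_of_sequence_nonempty_isCompact_isClosed K
    (fun n r hr => ⟨fun i hi => hr.1 i (by omega), fun i hi => hr.2 i (by omega)⟩)
    (fun n => by
      obtain ⟨s, hs⟩ := hne n
      obtain ⟨r, hr, -⟩ := hK n s hs
      exact ⟨r, hr⟩)
    (hclosed 0).isCompact hclosed
  rw [Set.mem_iInter] at hr
  exact ⟨r, fun t => ⟨(hr t).1 t le_rfl, (hr (t + 1)).2 t (by omega)⟩⟩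

theorem infOcc_inter_nonempty_iff {S : Type} [Finite S] (r : ℕ → S) (X : Set S) :
    (InfOcc r ∩ X).Nonempty ↔ ∀ N, ∃ t, N ≤ t ∧ r t ∈ X := by
  constructor
  · rintro ⟨s, hs, hX⟩ N
    obtain ⟨t, ht, rfl⟩ := hs N
    exact ⟨t, ht, hX⟩
  · intro h
    by_contra hne
    have h1 : ∀ s : S, ∃ N, s ∈ X → ∀ t, N ≤ t → r t ≠ s := by
      intro s
      by_contra! hs
      exact hne ⟨s, fun N => (hs N).2, (hs 0).1⟩
    choose N hN using h1
    obtain ⟨B, hB⟩ := (Set.finite_range N).bddAbove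
    obtain ⟨t, ht, htX⟩ := h B
    exact hN (r t) htX t ((hB ⟨r t, rfl⟩).trans ht) rfl

theorem infOcc_inter_eq_empty_iff {S : Type} [Finite S] (r : ℕ → S) (X : Set S) :
    InfOcc r ∩ X = ∅ ↔ ∃ N, ∀ t, N ≤ t → r t ∉ X := by
  rw [← Set.not_nonempty_iff_eq_empty, infOcc_inter_nonempty_iff]
  push Not
  rfl

/-- Parity acceptance when the classes are the fibres of a colouring. -/
theorem parityAccept_fibres_iff {T : Type} [Finite T] {k : ℕ} (col : T → Fin k) (r : ℕ → T) :
    ParityAccept (fun c => {x | col x = c}) r ↔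
      ∃ c : ℕ, Even c ∧ (∀ N, ∃ t, N ≤ t ∧ (col (r t) : ℕ) = c) ∧
        ∃ N, ∀ t, N ≤ t → c ≤ (col (r t) : ℕ) := by
  unfold ParityAccept
  simp only [infOcc_inter_nonempty_iff, infOcc_inter_eq_empty_iff, Set.mem_ofPred_eq]
  constructor
  · rintro ⟨i, hi, h1, h2⟩
    refine ⟨i, hi, fun N => ?_, ?_⟩
    · obtain ⟨t, ht, h⟩ := h1 N
      exact ⟨t, ht, by rw [h]⟩
    · have h3 : ∀ j : Fin k, ∃ N, j < i → ∀ t, N ≤ t → col (r t) ≠ j := by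
        intro j
        by_cases hj : j < i
        · obtain ⟨N, hN⟩ := h2 j hj
          exact ⟨N, fun _ => hN⟩
        · exact ⟨0, fun h => absurd h hj⟩
      choose N hN using h3
      obtain ⟨B, hB⟩ := (Set.finite_range N).bddAbove
      refine ⟨B, fun t ht => ?_⟩
      by_contra hlt
      exact hN (col (r t)) (Fin.lt_def.2 (by omega)) t ((hB ⟨_, rfl⟩).trans ht) rfl
  · rintro ⟨c, hc, h1, N, hN⟩
    obtain ⟨t, -, ht⟩ := h1 0
    refine ⟨col (r t), by rwa [ht], fun M => ?_, fun j hj => ⟨N, fun u hu h => ?_⟩⟩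
    · obtain ⟨u, hu, h⟩ := h1 M
      exact ⟨u, hu, Fin.ext (by omega)⟩
    · have := hN u hu
      rw [h] at this
      have := Fin.lt_def.1 hj
      omega

theorem isPartition_fibres {T : Type} {k : ℕ} (col : T → Fin k) :
    IsPartition (fun c => {x | col x = c}) := by
  refine ⟨fun i j hij => ?_, ?_⟩
  · ext x
    simp only [Set.mem_inter_iff, Set.mem_ofPred_eq, Set.mem_empty_iff_false, iff_false]
    rintro ⟨rfl, h⟩
    exact hij h
  · ext x
    simp

/-- The subset construction handles Streett automata without pairs. -/
theorem streett_zero_pairs {A S : Type} [Fintype S] (hn : 1 ≤ Fintype.card S)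
    (δ : S → A → Set S) (s0 : S) (R G : Fin 0 → Set S) :
    ∃ (T : Type) (instT : Fintype T) (δ' : T → A → T) (t0 : T)
      (F : Fin (2 * (Fintype.card S * (0 + 1))) → Set T),
      @Fintype.card T instT ≤
        2 * Fintype.card S ^ Fintype.card S * (0 + 1) ^ (Fintype.card S * (0 + 1)) *
          (Fintype.card S * (0 + 1)).factorial ∧
      IsPartition F ∧
      {w : ℕ → A | ParityAccept F (DetRun δ' t0 w)} = StreettLang δ s0 R G := by
  classical
  have hm : 0 < 2 * (Fintype.card S * (0 + 1)) := by omega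
  have hm' : 1 < 2 * (Fintype.card S * (0 + 1)) := by omega
  let col : Set S → Fin (2 * (Fintype.card S * (0 + 1))) := fun U =>
    if U.Nonempty then ⟨0, hm⟩ else ⟨1, hm'⟩
  let next : Set S → A → Set S := fun U a => {s' | ∃ s ∈ U, s' ∈ δ s a}
  refine ⟨Set S, inferInstance, next, {s0}, fun c => {x | col x = c}, ?_,
    isPartition_fibres col, ?_⟩
  · rw [Fintype.card_set]
    generalize Fintype.card S = n at hn
    simp only [zero_add, one_pow, mul_one]
    rcases hn.eq_or_lt with rfl | h
    · simp
    · calc 2 ^ n ≤ n ^ n := Nat.pow_le_pow_left h n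
        _ ≤ 2 * n ^ n := by omega
        _ ≤ 2 * n ^ n * n.factorial := Nat.le_mul_of_pos_right _ n.factorial_pos
  · ext w
    rw [Set.mem_ofPred_eq, parityAccept_fibres_iff]
    set U := DetRun next {s0} w with hU
    have hstep : ∀ t, U (t + 1) = next (U t) (w t) := fun t => rfl
    have hcol : ∀ t, (U t).Nonempty ↔ (col (U t) : ℕ) = 0 := by
      intro t
      by_cases h : (U t).Nonempty <;> simp [col, h]
    constructor
    · rintro ⟨c, hc, h1, -⟩
      have hne : ∀ t, (U t).Nonempty := by
        intro t
        obtain ⟨u, hu, h⟩ := h1 t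
        have hu0 : (U u).Nonempty := by
          by_contra hne
          have : (col (U u) : ℕ) = 1 := by simp [col, hne]
          rw [this] at h
          subst h
          exact absurd hc (by decide)
        clear h
        induction u, hu using Nat.le_induction with
        | base => exact hu0
        | succ u _ ih =>
          obtain ⟨s', s, hs, -⟩ := hu0
          exact ih ⟨s, hs⟩
      obtain ⟨r, hr⟩ := exists_path_of_levels U (fun t s s' => s' ∈ δ s (w t)) hne
        (fun t s' hs' => hs')
      exact ⟨r, ⟨(hr 0).1, fun t => (hr t).2⟩, fun i => i.elim0⟩
    · rintro ⟨r, ⟨h0, hr⟩, -⟩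
      have hmem : ∀ t, r t ∈ U t := by
        intro t
        induction t with
        | zero => exact h0
        | succ t ih => exact ⟨r t, ih, hr t⟩
      exact ⟨0, by decide, fun N => ⟨N, le_rfl, (hcol N).1 ⟨_, hmem N⟩⟩, 0, fun t _ => Nat.zero_le _⟩

/-! ### Branches

A branch of a Streett–Safra tree is the list of its edges below the root. The edge `(j, i)` leads to
the node named `i`; it drops the pair `j` from the set of pairs the subtree has to verify, and
`j = 0` drops none. -/

/-- Every edge of the branch drops a pair that is still present in `h`, or none. -/
def Adm : Finset ℕ → List (ℕ × ℕ) → Prop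
  | _, [] => True
  | h, x :: c => (x.1 = 0 ∨ x.1 ∈ h) ∧ Adm (h.erase x.1) c

/-- The pairs remaining after following a branch. -/
def remaining (h : Finset ℕ) (P : List (ℕ × ℕ)) : Finset ℕ :=
  P.foldl (fun h x => h.erase x.1) h

/-- The largest element of `h` below `j`, or `0`. -/
def nextBelow (h : Finset ℕ) (j : ℕ) : ℕ := (h.filter (· < j)).sup id

/-- The name of the last node of a branch; the root is named `0`. -/
def lastId (P : List (ℕ × ℕ)) : ℕ := (P.getLast?.map Prod.snd).getD 0

open scoped Classical in
/-- The branch of a successor `s` of a state on a given branch. Fresh nodes are named `f`. -/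
noncomputable def advance {S : Type} (R G : ℕ → Set S) (f : ℕ) (s : S) :
    Finset ℕ → List (ℕ × ℕ) → List (ℕ × ℕ)
  | h, [] => [(h.sup id, f)]
  | h, x :: c =>
    if s ∈ R x.1 then [(nextBelow h x.1, f)]
    else if s ∈ G x.1 then [(x.1, f)]
    else x :: advance R G f s (h.erase x.1) c

@[simp] theorem lastId_nil : lastId [] = 0 := rfl

@[simp] theorem lastId_concat (P : List (ℕ × ℕ)) (x : ℕ × ℕ) : lastId (P ++ [x]) = x.2 := by
  simp [lastId]

theorem sup_id_eq_zero_or_mem (h : Finset ℕ) : h.sup id = 0 ∨ h.sup id ∈ h := by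
  rcases h.eq_empty_or_nonempty with rfl | hne
  · left; rfl
  · right
    obtain ⟨i, hi, h'⟩ := h.exists_mem_eq_sup hne id
    rw [h']
    exact hi

theorem le_sup_id {h : Finset ℕ} {j : ℕ} (hj : j ∈ h) : j ≤ h.sup id :=
  Finset.le_sup (f := id) hj

theorem nextBelow_eq_zero_or_mem (h : Finset ℕ) (j : ℕ) :
    nextBelow h j = 0 ∨ nextBelow h j ∈ h := by
  rcases sup_id_eq_zero_or_mem (h.filter (· < j)) with h' | h'
  · exact Or.inl h'
  · exact Or.inr (Finset.mem_filter.1 h').1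

theorem nextBelow_lt {h : Finset ℕ} {j : ℕ} (hj : 0 < j) : nextBelow h j < j := by
  rcases sup_id_eq_zero_or_mem (h.filter (· < j)) with h' | h'
  · unfold nextBelow
    omega
  · exact (Finset.mem_filter.1 h').2

theorem le_nextBelow {h : Finset ℕ} {j j' : ℕ} (hj : j ∈ h) (hlt : j < j') :
    j ≤ nextBelow h j' :=
  le_sup_id (Finset.mem_filter.2 ⟨hj, hlt⟩)

theorem Adm.of_prefix {h : Finset ℕ} {P c : List (ℕ × ℕ)} (hc : Adm h c) (hP : P <+: c) :
    Adm h P := by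
  induction P generalizing h c with
  | nil => trivial
  | cons x P ih =>
    obtain ⟨d, rfl⟩ := hP
    exact ⟨hc.1, ih hc.2 ⟨d, rfl⟩⟩

theorem Adm.countP_le {h : Finset ℕ} {c : List (ℕ × ℕ)} (hc : Adm h c) :
    c.countP (fun x => x.1 ≠ 0) ≤ h.card := by
  induction c generalizing h with
  | nil => simp
  | cons x c ih =>
    have h1 := ih hc.2
    rw [List.countP_cons]
    by_cases hx : x.1 = 0
    · have := Finset.card_erase_le (s := h) (a := x.1)
      simp only [hx, ne_eq, not_true_eq_false, decide_false, Bool.false_eq_true, if_false] at *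
      omega
    · have h2 := hc.1.resolve_left hx
      have := Finset.card_erase_add_one h2
      simp only [hx, ne_eq, not_false_eq_true, decide_true, if_true] at *
      omega

theorem Adm.fst_mem {h : Finset ℕ} {c : List (ℕ × ℕ)} (hc : Adm h c) {x : ℕ × ℕ} (hx : x ∈ c) :
    x.1 = 0 ∨ x.1 ∈ h := by
  induction c generalizing h with
  | nil => simp at hx
  | cons y c ih =>
    rcases List.mem_cons.1 hx with rfl | hx
    · exact hc.1
    · exact (ih hc.2 hx).imp_right Finset.mem_of_mem_erase

theorem adm_congr {h : Finset ℕ} {c : List (ℕ × ℕ)} (f : ℕ × ℕ → ℕ × ℕ)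
    (hf : ∀ x, (f x).1 = x.1) : Adm h (c.map f) ↔ Adm h c := by
  induction c generalizing h with
  | nil => simp [Adm]
  | cons x c ih => simp [Adm, hf, ih]

theorem mem_remaining {h : Finset ℕ} {P : List (ℕ × ℕ)} {j : ℕ} :
    j ∈ remaining h P ↔ j ∈ h ∧ ∀ x ∈ P, x.1 ≠ j := by
  induction P generalizing h with
  | nil => simp [remaining]
  | cons x P ih =>
    have : remaining h (x :: P) = remaining (h.erase x.1) P := rfl
    rw [this, ih, Finset.mem_erase]
    simp only [List.forall_mem_cons]
    constructor
    · rintro ⟨⟨h1, h2⟩, h3⟩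
      exact ⟨h2, Ne.symm h1, h3⟩
    · rintro ⟨h2, h1, h3⟩
      exact ⟨⟨Ne.symm h1, h2⟩, h3⟩

section Advance

variable {S : Type} {R G : ℕ → Set S} {f : ℕ} {s : S}

theorem advance_eq_concat (h : Finset ℕ) (c : List (ℕ × ℕ)) :
    ∃ p j, advance R G f s h c = p ++ [(j, f)] ∧ p <+: c := by
  induction c generalizing h with
  | nil => exact ⟨[], _, rfl, List.prefix_rfl⟩
  | cons x c ih =>
    unfold advance
    split_ifs
    · exact ⟨[], _, rfl, List.nil_prefix⟩
    · exact ⟨[], _, rfl, List.nil_prefix⟩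
    · obtain ⟨p, j, hp, hpc⟩ := ih (h.erase x.1)
      exact ⟨x :: p, j, by rw [hp]; rfl, List.cons_prefix_cons.2 ⟨rfl, hpc⟩⟩

theorem Adm.advance {h : Finset ℕ} {c : List (ℕ × ℕ)} (hc : Adm h c) :
    Adm h (advance R G f s h c) := by
  induction c generalizing h with
  | nil => exact ⟨sup_id_eq_zero_or_mem h, trivial⟩
  | cons x c ih =>
    unfold _root_.advance
    split_ifs
    · exact ⟨nextBelow_eq_zero_or_mem h _, trivial⟩
    · exact ⟨hc.1, trivial⟩
    · exact ⟨hc.1, ih hc.2⟩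

theorem advance_append {P : List (ℕ × ℕ)} (hP : ∀ x ∈ P, s ∉ R x.1 ∧ s ∉ G x.1)
    (h : Finset ℕ) (c : List (ℕ × ℕ)) :
    advance R G f s h (P ++ c) = P ++ advance R G f s (remaining h P) c := by
  induction P generalizing h with
  | nil => rfl
  | cons x P ih =>
    rw [List.forall_mem_cons] at hP
    simp only [List.cons_append, advance, if_neg hP.1.1, if_neg hP.1.2, ih hP.2]
    rfl

theorem prefix_of_prefix_advance {P : List (ℕ × ℕ)} (hf : ∀ x ∈ P, x.2 ≠ f)
    {h : Finset ℕ} {c : List (ℕ × ℕ)} (hP : P <+: advance R G f s h c) :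
    P <+: c ∧ ∀ x ∈ P, s ∉ R x.1 ∧ s ∉ G x.1 := by
  induction P generalizing h c with
  | nil => simp
  | cons y P ih =>
    rw [List.forall_mem_cons] at hf
    have hsingle : ∀ j, ¬ (y :: P <+: [(j, f)]) := by
      intro j hj
      rw [List.cons_prefix_cons] at hj
      exact hf.1 (by rw [hj.1])
    cases c with
    | nil => exact absurd hP (hsingle _)
    | cons x c =>
      unfold advance at hP
      split_ifs at hP with h1 h2
      · exact absurd hP (hsingle _)
      · exact absurd hP (hsingle _)
      · rw [List.cons_prefix_cons] at hP
        obtain ⟨rfl, hP⟩ := hP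
        obtain ⟨h3, h4⟩ := ih hf.2 hP
        exact ⟨List.cons_prefix_cons.2 ⟨rfl, h3⟩, List.forall_mem_cons.2 ⟨⟨h1, h2⟩, h4⟩⟩

end Advance

/-- `u` precedes `v` in the order where, at the node where the branches split, smaller pairs come
first and then older nodes. -/
def Precedes (u v : List (ℕ × ℕ)) : Prop :=
  ∀ P x y a b, u = P ++ x :: a → v = P ++ y :: b → x.1 < y.1 ∨ x.1 = y.1 ∧ x.2 ≤ y.2

theorem exists_precedes {X : Set (List (ℕ × ℕ))} (hfin : X.Finite) (hne : X.Nonempty) :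
    ∃ u ∈ X, ∀ v ∈ X, Precedes u v := by
  let key : List (ℕ × ℕ) → List (ℕ ×ₗ ℕ) := List.map toLex
  obtain ⟨u, hu, hmin⟩ := Set.exists_min_image X key hfin hne
  refine ⟨u, hu, ?_⟩
  rintro v hv P x y a b rfl rfl
  have h := hmin _ hv
  simp only [key, List.map_append, List.map_cons] at h
  have h2 : toLex x ≤ toLex y := by
    by_contra hlt
    rw [not_le] at hlt
    exact absurd h (not_le.2 (List.append_left_lt (List.cons_lt_cons_iff.2 (Or.inl hlt))))
  exact Prod.Lex.toLex_le_toLex.1 h2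

theorem exists_truncation (green : List (ℕ × ℕ) → Prop) (c : List (ℕ × ℕ)) :
    ∃ d, d <+: c ∧ (∀ P, P <+: d → P ≠ d → ¬ green P) ∧ (d = c ∨ green d) := by
  classical
  by_cases h : ∃ l, green (c.take l)
  · refine ⟨c.take (Nat.find h), List.take_prefix _ _, ?_, Or.inr (Nat.find_spec h)⟩
    intro P hP hne hg
    have hPc := hP.trans (List.take_prefix _ _)
    have hlen : P.length < Nat.find h := by
      have h1 := hP.length_le
      have h2 : P.length ≠ (c.take (Nat.find h)).length := fun e => hne (hP.eq_of_length e)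
      have := List.length_take_le (Nat.find h) c
      omega
    apply Nat.find_min h hlen
    rwa [← List.prefix_iff_eq_take.1 hPc]
  · push Not at h
    refine ⟨c, List.prefix_rfl, fun P hP _ hg => ?_, Or.inl rfl⟩
    apply h P.length
    rwa [← List.prefix_iff_eq_take.1 hP]

theorem map_injOn {α β : Type*} {f : α → β} {l l' : List α}
    (hf : ∀ x ∈ l, ∀ y ∈ l', f x = f y → x = y) (h : l.map f = l'.map f) : l = l' := by
  induction l generalizing l' with
  | nil =>
    symm
    simpa using h.symm
  | cons x l ih =>
    cases l' with
    | nil => simp at h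
    | cons y l' =>
      simp only [List.map_cons, List.cons.injEq] at h
      rw [hf x (by simp) y (by simp) h.1,
        ih (fun a ha b hb => hf a (by simp [ha]) b (by simp [hb])) h.2]

/-! ### Trees -/

/-- The node at the end of `P` is present in the tree `C`, which assigns to every present state
the branch of its leaf. -/
def Alive {S : Type} (C : S → Option (List (ℕ × ℕ))) (P : List (ℕ × ℕ)) : Prop :=
  ∃ s c, C s = some c ∧ P <+: c

/-- The names of the non-root nodes of a tree. -/
def names {S : Type} (C : S → Option (List (ℕ × ℕ))) : Set ℕ :=
  {i | ∃ P x, Alive C (P ++ [x]) ∧ x.2 = i}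

/-- Streett–Safra trees over `k` pairs, with arbitrary names, in which a node may have only sons
that drop no pair. -/
structure IsPretree {S : Type} (k : ℕ) (C : S → Option (List (ℕ × ℕ))) : Prop where
  increasing : ∀ P, Alive C P → P.Pairwise (fun x y => x.2 < y.2)
  pos : ∀ P, Alive C P → ∀ x ∈ P, 1 ≤ x.2
  unique : ∀ P x P' x', Alive C (P ++ [x]) → Alive C (P' ++ [x']) → x.2 = x'.2 →
    P ++ [x] = P' ++ [x']
  adm : ∀ P, Alive C P → Adm (Finset.Icc 1 k) P
  leaf : ∀ s c x, C s = some c → ¬ Alive C (c ++ [x])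

/-- Streett–Safra trees over `k` pairs, with arbitrary names. -/
structure IsTree {S : Type} (k : ℕ) (C : S → Option (List (ℕ × ℕ))) : Prop
    extends IsPretree k C where
  strict : ∀ P x, Alive C (P ++ [x]) → ∃ x', x'.1 ≠ 0 ∧ Alive C (P ++ [x'])

/-- Trees whose non-root nodes are named by an initial segment of the positive integers. -/
structure IsCompactTree {S : Type} (k : ℕ) (C : S → Option (List (ℕ × ℕ))) : Prop
    extends IsTree k C where
  compact : ∃ t, ∀ i, i ∈ names C ↔ 1 ≤ i ∧ i ≤ t

section Tree

variable {S : Type} {k : ℕ} {C D : S → Option (List (ℕ × ℕ))}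

theorem Alive.of_prefix {P Q : List (ℕ × ℕ)} (hP : Alive C P) (h : Q <+: P) : Alive C Q := by
  obtain ⟨s, c, hs, hc⟩ := hP
  exact ⟨s, c, hs, h.trans hc⟩

theorem alive_of_eq_some {s : S} {c : List (ℕ × ℕ)} (h : C s = some c) : Alive C c :=
  ⟨s, c, h, List.prefix_rfl⟩

theorem Alive.mem_names {P : List (ℕ × ℕ)} (hP : Alive C P) {x : ℕ × ℕ} (hx : x ∈ P) :
    x.2 ∈ names C := by
  obtain ⟨Q, T, rfl⟩ := List.append_of_mem hx
  exact ⟨Q, x, hP.of_prefix (by simp), rfl⟩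

theorem IsTree.le_lastId (hC : IsTree k C) {P : List (ℕ × ℕ)} (hP : Alive C P) {x : ℕ × ℕ}
    (hx : x ∈ P) : x.2 ≤ lastId P := by
  have h := hC.increasing P hP
  rcases List.eq_nil_or_concat P with rfl | ⟨Q, y, rfl⟩
  · simp at hx
  · rw [List.concat_eq_append] at *
    rw [lastId_concat]
    rw [List.pairwise_append] at h
    rcases List.mem_append.1 hx with hx | hx
    · exact (h.2.2 x hx y (by simp)).le
    · simp only [List.mem_singleton] at hx
      rw [hx]

theorem IsTree.zero_notMem_names (hC : IsTree k C) : 0 ∉ names C := by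
  rintro ⟨P, x, hP, hx⟩
  have := hC.pos _ hP x (by simp)
  omega

theorem IsTree.eq_of_lastId_eq (hC : IsTree k C) {P Q : List (ℕ × ℕ)} (hP : Alive C P)
    (hQ : Alive C Q) (h : lastId P = lastId Q) : P = Q := by
  have hp := hC.pos P hP
  have hq := hC.pos Q hQ
  rcases List.eq_nil_or_concat P with rfl | ⟨P, x, rfl⟩ <;>
    rcases List.eq_nil_or_concat Q with rfl | ⟨Q, y, rfl⟩ <;>
    simp only [List.concat_eq_append, lastId_concat, lastId_nil] at *
  · have := hq y (by simp)
    omega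
  · have := hp x (by simp)
    omega
  · exact hC.unique P x Q y hP hQ h

theorem IsCompactTree.names_le (hC : IsCompactTree k C) {i j : ℕ} (hi : i ∈ names C)
    (hj : 1 ≤ j) (hji : j ≤ i) : j ∈ names C := by
  obtain ⟨t, ht⟩ := hC.compact
  exact (ht j).2 ⟨hj, hji.trans ((ht i).1 hi).2⟩

/-- From every node one can descend to a leaf along edges that drop a pair. -/
theorem IsTree.exists_strict_descent (hC : IsTree k C) {P : List (ℕ × ℕ)} (hP : Alive C P) :
    ∃ s q, C s = some (P ++ q) ∧ ∀ x ∈ q, x.1 ≠ 0 := by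
  obtain ⟨m, hm⟩ : ∃ m, k - P.countP (fun x => x.1 ≠ 0) = m := ⟨_, rfl⟩
  induction m using Nat.strong_induction_on generalizing P with
  | _ m ih =>
  obtain ⟨s, c, hs, q, rfl⟩ := id hP
  cases q with
  | nil => exact ⟨s, [], hs, by simp⟩
  | cons x q =>
    obtain ⟨x', hx', hal⟩ := hC.strict P x ⟨s, _, hs, by simp⟩
    have hle := (hC.adm _ hal).countP_le
    simp only [List.countP_append, List.countP_singleton, hx', ne_eq, not_false_eq_true,
      decide_true, if_true, Nat.card_Icc] at hle
    obtain ⟨s', q', hs', hq'⟩ := ih (k - (P ++ [x']).countP (fun x => x.1 ≠ 0)) (by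
      simp only [List.countP_append, List.countP_singleton, hx', ne_eq, not_false_eq_true,
        decide_true, if_true] at hm ⊢
      omega) hal rfl
    refine ⟨s', x' :: q', by simpa using hs', ?_⟩
    exact List.forall_mem_cons.2 ⟨hx', hq'⟩

/-- A tree has at most `|S| (k + 1)` nodes. -/
theorem IsTree.card_le [Fintype S] (hC : IsTree k C) (hne : ∃ s, C s ≠ none) {t : ℕ}
    (ht : ∀ i, 1 ≤ i → i ≤ t → i ∈ names C) : t + 1 ≤ Fintype.card S * (k + 1) := by
  have hP : ∀ i : Fin (t + 1), ∃ P, Alive C P ∧ lastId P = i := by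
    intro i
    by_cases hi : (i : ℕ) = 0
    · obtain ⟨s, hs⟩ := hne
      obtain ⟨c, hc⟩ := Option.ne_none_iff_exists'.1 hs
      exact ⟨[], ⟨s, c, hc, List.nil_prefix⟩, by simp [hi]⟩
    · obtain ⟨P, x, hal, hx⟩ := ht i (by omega) (by omega)
      exact ⟨P ++ [x], hal, by simpa using hx⟩
  choose P hal hid using hP
  choose s q hs hq using fun i => hC.exists_strict_descent (hal i)
  have hlt : ∀ i, (P i).countP (fun x => x.1 ≠ 0) < k + 1 := by
    intro i
    have := (hC.adm _ (hal i)).countP_le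
    rw [Nat.card_Icc] at this
    omega
  have key : ∀ i j, s i = s j →
      (P i).countP (fun x => x.1 ≠ 0) = (P j).countP (fun x => x.1 ≠ 0) →
      P i <+: P j → P i = P j := by
    intro i j hsij hcount hpre
    obtain ⟨d, hd⟩ := hpre
    have h1 : some (P i ++ q i) = some (P j ++ q j) := by rw [← hs, ← hs, hsij]
    rw [Option.some.injEq, ← hd, List.append_assoc, List.append_cancel_left_eq] at h1
    rw [← hd, List.countP_append] at hcount
    have h2 : d.countP (fun x => x.1 ≠ 0) = 0 := by omega
    rw [List.countP_eq_zero] at h2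
    have h3 : d = [] := by
      rw [List.eq_nil_iff_forall_not_mem]
      intro x hx
      exact h2 x hx (by simpa using hq i x (by rw [h1]; simp [hx]))
    rw [← hd, h3, List.append_nil]
  have hinj : Function.Injective fun i : Fin (t + 1) =>
      (s i, (⟨(P i).countP (fun x => x.1 ≠ 0), hlt i⟩ : Fin (k + 1))) := by
    intro i j hij
    simp only [Prod.mk.injEq, Fin.mk.injEq] at hij
    have h1 : P i ++ q i = P j ++ q j := by
      rw [← Option.some.injEq, ← hs, ← hs, hij.1]
    have h2 : P i = P j := by
      rcases List.prefix_or_prefix_of_prefix (List.prefix_append (P i) (q i))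
        (h1 ▸ List.prefix_append (P j) (q j)) with h | h
      · exact key i j hij.1 hij.2 h
      · exact (key j i hij.1.symm hij.2.symm h).symm
    apply Fin.ext
    rw [← hid, ← hid, h2]
  simpa using Fintype.card_le_of_injective _ hinj

theorem IsCompactTree.lt_of_mem_names [Fintype S] (hC : IsCompactTree k C) {i : ℕ}
    (hi : i ∈ names C) : i < Fintype.card S * (k + 1) := by
  obtain ⟨P, x, ⟨s, c, hs, -⟩, -⟩ := id hi
  exact hC.toIsTree.card_le ⟨s, by simp [hs]⟩ fun j hj hji => hC.names_le hi hj hji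

theorem isCompactTree_single [DecidableEq S] (k : ℕ) (s0 : S) :
    IsCompactTree k (fun s => if s = s0 then some [] else none) := by
  have h : ∀ P, Alive (fun s => if s = s0 then some ([] : List (ℕ × ℕ)) else none) P → P = [] := by
    rintro P ⟨s, c, hs, hc⟩
    dsimp only at hs
    split_ifs at hs
    simp only [Option.some.injEq] at hs
    subst hs
    exact List.prefix_nil.1 hc
  refine ⟨⟨⟨?_, ?_, ?_, ?_, ?_⟩, ?_⟩, ?_⟩
  · intro P hP
    simp [h P hP]
  · intro P hP
    simp [h P hP]
  · intro P x P' x' hP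
    simpa using h _ hP
  · intro P hP
    rw [h P hP]
    trivial
  · intro s c x _ hP
    simpa using h _ hP
  · intro P x hP
    simpa using h _ hP
  · refine ⟨0, fun i => ⟨?_, fun hi => by omega⟩⟩
    rintro ⟨P, x, hP, -⟩
    simpa using h _ hP

/-! ### Renaming -/

/-- Rename the nodes of a branch. -/
def rename (f : ℕ → ℕ) (P : List (ℕ × ℕ)) : List (ℕ × ℕ) := P.map fun x => (x.1, f x.2)

theorem alive_rename_iff {f : ℕ → ℕ} {Q : List (ℕ × ℕ)} :
    Alive (fun s => (D s).map (rename f)) Q ↔ ∃ P, Alive D P ∧ Q = rename f P := by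
  constructor
  · rintro ⟨s, c, hs, hc⟩
    obtain ⟨d, hd, rfl⟩ := Option.map_eq_some_iff.1 hs
    obtain ⟨P, hP, rfl⟩ := List.prefix_map_iff.1 hc
    exact ⟨P, ⟨s, d, hd, hP⟩, rfl⟩
  · rintro ⟨P, ⟨s, d, hd, hP⟩, rfl⟩
    exact ⟨s, rename f d, by simp [hd], hP.map _⟩

theorem rename_eq_concat {f : ℕ → ℕ} {P Q : List (ℕ × ℕ)} {y : ℕ × ℕ}
    (h : Q ++ [y] = rename f P) :
    ∃ P' x, P = P' ++ [x] ∧ Q = rename f P' ∧ y = (x.1, f x.2) := by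
  rcases List.eq_nil_or_concat P with rfl | ⟨P', x, rfl⟩
  · simp [rename] at h
  · rw [List.concat_eq_append] at *
    simp only [rename, List.map_append, List.map_cons, List.map_nil] at h
    have := List.append_inj' h rfl
    exact ⟨P', x, rfl, this.1, by simpa using this.2⟩

theorem rename_eq_self {f : ℕ → ℕ} {P : List (ℕ × ℕ)} (h : ∀ x ∈ P, f x.2 = x.2) :
    rename f P = P := by
  conv_rhs => rw [← List.map_id P]
  apply List.map_congr_left
  intro x hx
  simp [h x hx]

theorem names_rename {f : ℕ → ℕ} :
    names (fun s => (D s).map (rename f)) = f '' names D := by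
  ext i
  constructor
  · rintro ⟨Q, y, hal, rfl⟩
    obtain ⟨P, hP, h⟩ := alive_rename_iff.1 hal
    obtain ⟨P', x, rfl, -, rfl⟩ := rename_eq_concat h
    exact ⟨x.2, ⟨P', x, hP, rfl⟩, rfl⟩
  · rintro ⟨_, ⟨P, x, hP, rfl⟩, rfl⟩
    exact ⟨rename f P, (x.1, f x.2), alive_rename_iff.2 ⟨_, hP, by simp [rename]⟩, rfl⟩

theorem IsTree.rename (hD : IsTree k D) {f : ℕ → ℕ} (hf : StrictMonoOn f (names D))
    (hpos : ∀ i ∈ names D, 1 ≤ f i) : IsTree k (fun s => (D s).map (rename f)) := by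
  have hinj : ∀ P Q, Alive D P → Alive D Q → _root_.rename f P = _root_.rename f Q → P = Q := by
    intro P Q hP hQ h
    refine map_injOn ?_ h
    intro x hx y hy hxy
    simp only [Prod.mk.injEq] at hxy
    exact Prod.ext hxy.1 (hf.injOn (hP.mem_names hx) (hQ.mem_names hy) hxy.2)
  refine ⟨⟨?_, ?_, ?_, ?_, ?_⟩, ?_⟩
  · intro Q hQ
    obtain ⟨P, hP, rfl⟩ := alive_rename_iff.1 hQ
    have h := hD.increasing P hP
    rw [_root_.rename, List.pairwise_map]
    exact List.Pairwise.imp_of_mem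
      (fun hx hy hxy => hf (hP.mem_names hx) (hP.mem_names hy) hxy) h
  · intro Q hQ y hy
    obtain ⟨P, hP, rfl⟩ := alive_rename_iff.1 hQ
    obtain ⟨x, hx, rfl⟩ := List.mem_map.1 hy
    exact hpos _ (hP.mem_names hx)
  · intro Q y Q' y' hQ hQ' hy
    obtain ⟨P, hP, h⟩ := alive_rename_iff.1 hQ
    obtain ⟨P', hP', h'⟩ := alive_rename_iff.1 hQ'
    rw [h, h']
    obtain ⟨P, x, rfl, -, rfl⟩ := rename_eq_concat h
    obtain ⟨P', x', rfl, -, rfl⟩ := rename_eq_concat h'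
    rw [hD.unique P x P' x' hP hP'
      (hf.injOn (hP.mem_names (by simp)) (hP'.mem_names (by simp)) hy)]
  · intro Q hQ
    obtain ⟨P, hP, rfl⟩ := alive_rename_iff.1 hQ
    exact (adm_congr (fun x => (x.1, f x.2)) fun _ => rfl).2 (hD.adm P hP)
  · intro s c y hs hal
    obtain ⟨d, hd, rfl⟩ := Option.map_eq_some_iff.1 hs
    obtain ⟨P, hP, h⟩ := alive_rename_iff.1 hal
    obtain ⟨P, x, rfl, h', -⟩ := rename_eq_concat h
    have := hinj d P (alive_of_eq_some hd) (hP.of_prefix (by simp)) h'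
    subst this
    exact hD.leaf s d x hd hP
  · intro Q y hQ
    obtain ⟨P, hP, h⟩ := alive_rename_iff.1 hQ
    obtain ⟨P, x, rfl, rfl, -⟩ := rename_eq_concat h
    obtain ⟨x', hx', hal⟩ := hD.strict P x hP
    exact ⟨(x'.1, f x'.2), hx', alive_rename_iff.2 ⟨_, hal, by simp [_root_.rename]⟩⟩

open scoped Classical in
/-- The rank of `i` among the elements of `N`. -/
noncomputable def rankIn (N : Set ℕ) (i : ℕ) : ℕ := Nat.count (· ∈ N) (i + 1)

theorem rankIn_strictMonoOn (N : Set ℕ) : StrictMonoOn (rankIn N) N := by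
  classical
  intro i _ j hj hij
  unfold rankIn
  rw [Nat.count_succ (· ∈ N) j, if_pos hj]
  exact Nat.lt_succ_of_le (Nat.count_monotone _ hij)

theorem one_le_rankIn {N : Set ℕ} {i : ℕ} (hi : i ∈ N) : 1 ≤ rankIn N i := by
  classical
  unfold rankIn
  rw [Nat.count_succ, if_pos hi]
  omega

theorem rankIn_le {N : Set ℕ} (h0 : 0 ∉ N) (i : ℕ) : rankIn N i ≤ i := by
  classical
  unfold rankIn
  rw [Nat.count_succ', if_neg h0]
  exact Nat.count_le _

theorem rankIn_eq_self_iff {N : Set ℕ} (h0 : 0 ∉ N) (i : ℕ) :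
    rankIn N i = i ↔ ∀ j, 1 ≤ j → j ≤ i → j ∈ N := by
  classical
  unfold rankIn
  rw [Nat.count_succ', if_neg h0, add_zero, Nat.count_iff_forall]
  constructor
  · intro h j hj hji
    have := h (j - 1) (by omega)
    rwa [Nat.sub_add_cancel hj] at this
  · intro h j hj
    exact h (j + 1) (by omega) (by omega)

theorem exists_rankIn_image {N : Set ℕ} (hfin : N.Finite) :
    ∃ t, ∀ i, i ∈ rankIn N '' N ↔ 1 ≤ i ∧ i ≤ t := by
  classical
  refine ⟨N.ncard, fun i => ⟨?_, ?_⟩⟩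
  · rintro ⟨j, hj, rfl⟩
    refine ⟨one_le_rankIn hj, ?_⟩
    rw [rankIn, Nat.count_eq_card_filter_range, ← Set.ncard_coe_finset]
    refine Set.ncard_le_ncard ?_ hfin
    intro x hx
    simpa using (Finset.mem_filter.1 hx).2
  · rintro ⟨h1, h2⟩
    have hlt : ∀ hf : (Set.ofPred (· ∈ N)).Finite, i - 1 < hf.toFinset.card := by
      intro hf
      rw [← Set.ncard_eq_toFinset_card _ hf]
      have : (Set.ofPred (· ∈ N)) = N := rfl
      rw [this]
      omega
    have hmem := Nat.nth_mem (p := (· ∈ N)) (i - 1) hlt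
    refine ⟨_, hmem, ?_⟩
    rw [rankIn, Nat.count_succ, if_pos hmem, Nat.count_nth hlt]
    omega

end Tree

/-! ### Green nodes -/

section Prune

variable {S : Type}

/-- All sons of the node at the end of `P` drop no pair. -/
def Green (B : S → Option (List (ℕ × ℕ))) (P : List (ℕ × ℕ)) : Prop :=
  Alive B P ∧ ∀ x, Alive B (P ++ [x]) → x.1 = 0

/-- Remove all descendants of green nodes. -/
noncomputable def prune (B : S → Option (List (ℕ × ℕ))) : S → Option (List (ℕ × ℕ)) := fun s =>
  (B s).map fun c => (exists_truncation (Green B) c).choose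

variable {k : ℕ} {B : S → Option (List (ℕ × ℕ))}

theorem exists_of_prune_eq_some {s : S} {d : List (ℕ × ℕ)} (h : prune B s = some d) :
    ∃ c, B s = some c ∧ d <+: c ∧ (∀ P, P <+: d → P ≠ d → ¬ Green B P) ∧ (d = c ∨ Green B d) := by
  obtain ⟨c, hc, rfl⟩ := Option.map_eq_some_iff.1 h
  exact ⟨c, hc, (exists_truncation (Green B) c).choose_spec⟩

theorem exists_prune_eq_some {s : S} {c : List (ℕ × ℕ)} (h : B s = some c) :
    ∃ d, prune B s = some d :=
  ⟨_, by unfold prune; rw [h]; rfl⟩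

theorem alive_of_alive_prune {P : List (ℕ × ℕ)} (h : Alive (prune B) P) : Alive B P := by
  obtain ⟨s, d, hd, hP⟩ := h
  obtain ⟨c, hc, hdc, -⟩ := exists_of_prune_eq_some hd
  exact ⟨s, c, hc, hP.trans hdc⟩

theorem exists_prune_of_not_green {s : S} {c P : List (ℕ × ℕ)} {y : ℕ × ℕ} (h : B s = some c)
    (hP : P ++ [y] <+: c) (hg : ∀ Q, Q <+: P → ¬ Green B Q) :
    ∃ d, prune B s = some d ∧ P ++ [y] <+: d := by
  obtain ⟨d, hd⟩ := exists_prune_eq_some h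
  obtain ⟨c', hc', hdc, -, hd'⟩ := exists_of_prune_eq_some hd
  rw [h, Option.some.injEq] at hc'
  subst hc'
  refine ⟨d, hd, ?_⟩
  rcases hd' with rfl | hgreen
  · exact hP
  · rcases List.prefix_or_prefix_of_prefix hP hdc with h1 | h1
    · exact h1
    · rcases List.prefix_concat_iff.1 h1 with rfl | h2
      · exact List.prefix_rfl
      · exact absurd hgreen (hg d h2)

theorem IsPretree.isTree_prune (hB : IsPretree k B) : IsTree k (prune B) := by
  refine ⟨⟨?_, ?_, ?_, ?_, ?_⟩, ?_⟩
  · exact fun P hP => hB.increasing P (alive_of_alive_prune hP)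
  · exact fun P hP => hB.pos P (alive_of_alive_prune hP)
  · exact fun P x P' x' hP hP' =>
      hB.unique P x P' x' (alive_of_alive_prune hP) (alive_of_alive_prune hP')
  · exact fun P hP => hB.adm P (alive_of_alive_prune hP)
  · intro s d x hs hal
    obtain ⟨c, hc, -, -, hd⟩ := exists_of_prune_eq_some hs
    rcases hd with rfl | hgreen
    · exact hB.leaf s d x hc (alive_of_alive_prune hal)
    · obtain ⟨s', d', hs', hd'⟩ := hal
      obtain ⟨-, -, -, hng, -⟩ := exists_of_prune_eq_some hs'
      refine hng d ((List.prefix_append d [x]).trans hd') ?_ hgreen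
      rintro rfl
      have := hd'.length_le
      simp at this
  · intro P x hal
    obtain ⟨s, d, hs, hd⟩ := id hal
    obtain ⟨-, -, -, hng, -⟩ := exists_of_prune_eq_some hs
    have hng' : ∀ Q, Q <+: P → ¬ Green B Q := by
      intro Q hQ
      refine hng Q (hQ.trans ((List.prefix_append P [x]).trans hd)) ?_
      rintro rfl
      have h1 := hd.length_le
      have h2 := hQ.length_le
      simp at h1
      omega
    have h1 := hng' P List.prefix_rfl
    unfold Green at h1
    push Not at h1
    obtain ⟨x', ⟨s', c', hs', hc'⟩, hx'⟩ :=
      h1 ((alive_of_alive_prune hal).of_prefix (List.prefix_append P [x]))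
    obtain ⟨d', hd', hpre⟩ := exists_prune_of_not_green hs' hc' hng'
    exact ⟨x', hx', s', d', hd', hpre⟩

end Prune

/-! ### The transition of the deterministic automaton -/

section Step

variable {S : Type} [Fintype S]

/-- The bound on the number of nodes of a tree; all names are smaller. -/
abbrev nodeBound (S : Type) [Fintype S] (k : ℕ) : ℕ := Fintype.card S * (k + 1)

/-- The name given to a node created for the state `s` during a transition. -/
noncomputable def freshName (k : ℕ) (s : S) : ℕ :=
  nodeBound S k + 1 + Fintype.equivFin S s

/-- The branches on which the state `s'` may be put by a transition. -/
def candidates (k : ℕ) (R G : ℕ → Set S) (E : S → Set S) (C : S → Option (List (ℕ × ℕ)))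
    (s' : S) : Set (List (ℕ × ℕ)) :=
  {u | ∃ s c, C s = some c ∧ s' ∈ E s ∧
    u = advance R G (freshName k s') s' (Finset.Icc 1 k) c}

theorem candidates_finite (k : ℕ) (R G : ℕ → Set S) (E : S → Set S)
    (C : S → Option (List (ℕ × ℕ))) (s' : S) : (candidates k R G E C s').Finite := by
  refine (Set.finite_range fun s =>
    advance R G (freshName k s') s' (Finset.Icc 1 k) ((C s).getD [])).subset ?_
  rintro u ⟨s, c, hs, -, rfl⟩
  exact ⟨s, by simp [hs]⟩

open scoped Classical in
/-- Advance all states, keeping for every state only the first of its branches. -/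
noncomputable def expand (k : ℕ) (R G : ℕ → Set S) (E : S → Set S)
    (C : S → Option (List (ℕ × ℕ))) : S → Option (List (ℕ × ℕ)) := fun s' =>
  if h : (candidates k R G E C s').Nonempty then
    some (exists_precedes (candidates_finite k R G E C s') h).choose
  else none

/-- The tree after a transition. -/
noncomputable def nextTree (k : ℕ) (R G : ℕ → Set S) (E : S → Set S)
    (C : S → Option (List (ℕ × ℕ))) : S → Option (List (ℕ × ℕ)) := fun s =>
  (prune (expand k R G E C) s).map (rename (rankIn (names (prune (expand k R G E C)))))

/-- The colour of a transition: `2 i` if the node `i` is green, `2 i - 1` if it is missing after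
the transition, whichever is smallest. -/
noncomputable def transitionColour (k : ℕ) (R G : ℕ → Set S) (E : S → Set S)
    (C : S → Option (List (ℕ × ℕ))) : ℕ :=
  sInf ({c | ∃ i, 1 ≤ i ∧ i ∉ names (prune (expand k R G E C)) ∧ c = 2 * i - 1} ∪
    {c | ∃ P, Green (expand k R G E C) P ∧ c = 2 * lastId P})

variable {k : ℕ} {R G : ℕ → Set S} {E : S → Set S} {C : S → Option (List (ℕ × ℕ))}

theorem lt_freshName (s : S) : nodeBound S k < freshName k s := by
  unfold freshName
  omega

theorem freshName_injective : Function.Injective (freshName k : S → ℕ) := by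
  intro s s' h
  unfold freshName at h
  exact (Fintype.equivFin S).injective (Fin.ext (by omega))

theorem exists_of_expand_eq_some {s' : S} {u : List (ℕ × ℕ)}
    (h : expand k R G E C s' = some u) : ∃ s c, C s = some c ∧ s' ∈ E s ∧
      u = advance R G (freshName k s') s' (Finset.Icc 1 k) c := by
  unfold expand at h
  split_ifs at h with hne
  rw [← Option.some.inj h]
  exact (exists_precedes (candidates_finite k R G E C s') hne).choose_spec.1

theorem exists_expand_eq_some {s s' : S} {c : List (ℕ × ℕ)} (hs : C s = some c)
    (hE : s' ∈ E s) : ∃ u, expand k R G E C s' = some u ∧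
      Precedes u (advance R G (freshName k s') s' (Finset.Icc 1 k) c) := by
  have hmem : advance R G (freshName k s') s' (Finset.Icc 1 k) c ∈ candidates k R G E C s' :=
    ⟨s, c, hs, hE, rfl⟩
  have hne : (candidates k R G E C s').Nonempty := ⟨_, hmem⟩
  refine ⟨_, by unfold expand; rw [dif_pos hne], ?_⟩
  exact (exists_precedes (candidates_finite k R G E C s') hne).choose_spec.2 _ hmem

theorem exists_concat_of_expand_eq_some {s : S} {u : List (ℕ × ℕ)}
    (h : expand k R G E C s = some u) :
    ∃ Q j, u = Q ++ [(j, freshName k s)] ∧ Alive C Q := by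
  obtain ⟨s₀, c, hs, -, hu⟩ := exists_of_expand_eq_some h
  obtain ⟨Q, j, hQ, hQc⟩ :=
    advance_eq_concat (R := R) (G := G) (f := freshName k s) (s := s) (Finset.Icc 1 k) c
  exact ⟨Q, j, hu.trans hQ, s₀, c, hs, hQc⟩

theorem alive_or_of_alive_expand {P : List (ℕ × ℕ)} (h : Alive (expand k R G E C) P) :
    Alive C P ∨ ∃ s Q j, expand k R G E C s = some P ∧ P = Q ++ [(j, freshName k s)] ∧
      Alive C Q := by
  obtain ⟨s, u, hu, hP⟩ := h
  obtain ⟨Q, j, rfl, hQ⟩ := exists_concat_of_expand_eq_some hu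
  rcases List.prefix_concat_iff.1 hP with rfl | hP
  · exact Or.inr ⟨s, Q, j, hu, rfl, hQ⟩
  · exact Or.inl (hQ.of_prefix hP)

theorem IsCompactTree.not_alive_fresh (hC : IsCompactTree k C) {P : List (ℕ × ℕ)} {x : ℕ × ℕ}
    {s : S} (hx : x ∈ P) (hs : x.2 = freshName k s) : ¬ Alive C P := by
  intro hP
  have h1 := hC.lt_of_mem_names (hP.mem_names hx)
  have h2 := lt_freshName (k := k) s
  rw [hs] at h1
  exact absurd h1 (by unfold nodeBound at h2; omega)

theorem IsCompactTree.isPretree_expand (hC : IsCompactTree k C) :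
    IsPretree k (expand k R G E C) := by
  refine ⟨?_, ?_, ?_, ?_, ?_⟩
  · intro P hP
    rcases alive_or_of_alive_expand hP with h | ⟨s, Q, j, -, rfl, hQ⟩
    · exact hC.increasing P h
    · rw [List.pairwise_append]
      refine ⟨hC.increasing Q hQ, by simp, ?_⟩
      intro x hx y hy
      rw [List.mem_singleton] at hy
      rw [hy]
      exact (hC.lt_of_mem_names (hQ.mem_names hx)).trans (lt_freshName s)
  · intro P hP x hx
    rcases alive_or_of_alive_expand hP with h | ⟨s, Q, j, -, rfl, hQ⟩
    · exact hC.pos P h x hx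
    · rcases List.mem_append.1 hx with hx | hx
      · exact hC.pos Q hQ x hx
      · rw [List.mem_singleton] at hx
        rw [hx]
        exact Nat.one_le_of_lt (lt_freshName s)
  · intro P x P' x' hP hP' hx
    rcases alive_or_of_alive_expand hP with h | ⟨s, Q, j, hs, hQ, -⟩ <;>
      rcases alive_or_of_alive_expand hP' with h' | ⟨s', Q', j', hs', hQ', -⟩
    · exact hC.unique P x P' x' h h' hx
    · have := List.append_inj' hQ' rfl
      simp only [List.cons.injEq, and_true] at this
      exact absurd h (hC.not_alive_fresh (x := x) (s := s') (by simp) (by rw [hx, this.2]))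
    · have := List.append_inj' hQ rfl
      simp only [List.cons.injEq, and_true] at this
      exact absurd h' (hC.not_alive_fresh (x := x') (s := s) (by simp) (by rw [← hx, this.2]))
    · have h1 := List.append_inj' hQ rfl
      have h2 := List.append_inj' hQ' rfl
      simp only [List.cons.injEq, and_true] at h1 h2
      rw [h1.2, h2.2] at hx
      rw [freshName_injective hx, hs'] at hs
      exact (Option.some.inj hs).symm
  · intro P hP
    rcases alive_or_of_alive_expand hP with h | ⟨s, Q, j, hs, -, -⟩
    · exact hC.adm P h
    · obtain ⟨s₀, c, hs₀, -, rfl⟩ := exists_of_expand_eq_some hs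
      exact (hC.adm c (alive_of_eq_some hs₀)).advance
  · intro s u x hs hal
    obtain ⟨Q, j, rfl, hQ⟩ := exists_concat_of_expand_eq_some hs
    have hnot : ¬ Alive C (Q ++ [(j, freshName k s)]) :=
      hC.not_alive_fresh (x := (j, freshName k s)) (s := s) (by simp) rfl
    rcases alive_or_of_alive_expand hal with h | ⟨s', Q', j', hs', hQ', hal'⟩
    · exact hnot (h.of_prefix (by simp))
    · rw [← (List.append_inj' hQ' rfl).1] at hal'
      exact hnot hal'

theorem IsCompactTree.mem_names_expand (hC : IsCompactTree k C) {i : ℕ}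
    (hi : i ∈ names (prune (expand k R G E C))) :
    i < nodeBound S k ∨ ∃ s : S, i = freshName k s := by
  obtain ⟨P, x, hal, rfl⟩ := hi
  rcases alive_or_of_alive_expand (alive_of_alive_prune hal) with h | ⟨s, Q, j, -, hQ, -⟩
  · exact Or.inl (hC.lt_of_mem_names (h.mem_names (by simp)))
  · have := List.append_inj' hQ rfl
    simp only [List.cons.injEq, and_true] at this
    exact Or.inr ⟨s, by rw [this.2]⟩

theorem IsCompactTree.isCompactTree_nextTree (hC : IsCompactTree k C) :
    IsCompactTree k (nextTree k R G E C) := by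
  have hD : IsTree k (prune (expand k R G E C)) := hC.isPretree_expand.isTree_prune
  refine ⟨hD.rename (rankIn_strictMonoOn _) fun i => one_le_rankIn, ?_⟩
  unfold nextTree
  rw [names_rename]
  refine exists_rankIn_image ?_
  refine ((Set.finite_Iio (nodeBound S k)).union (Set.finite_range (freshName k : S → ℕ))).subset ?_
  intro i hi
  rcases hC.mem_names_expand hi with h | ⟨s, rfl⟩
  · exact Or.inl h
  · exact Or.inr ⟨s, rfl⟩

theorem transitionColour_le_of_notMem {i : ℕ} (hi : 1 ≤ i)
    (h : i ∉ names (prune (expand k R G E C))) : transitionColour k R G E C ≤ 2 * i - 1 :=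
  Nat.sInf_le (Or.inl ⟨i, hi, h, rfl⟩)

theorem transitionColour_le_of_green {P : List (ℕ × ℕ)} (h : Green (expand k R G E C) P) :
    transitionColour k R G E C ≤ 2 * lastId P :=
  Nat.sInf_le (Or.inr ⟨P, h, rfl⟩)

theorem IsCompactTree.nodeBound_notMem_names (hC : IsCompactTree k C) :
    nodeBound S k ∉ names (prune (expand k R G E C)) := by
  intro h
  rcases hC.mem_names_expand h with h | ⟨s, h⟩
  · exact lt_irrefl _ h
  · exact (lt_freshName s).ne h

theorem IsCompactTree.transitionColour_lt (hC : IsCompactTree k C) (hS : 1 ≤ Fintype.card S) :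
    transitionColour k R G E C < 2 * nodeBound S k := by
  have hpos : 0 < nodeBound S k := Nat.mul_pos hS k.succ_pos
  have := transitionColour_le_of_notMem hpos (hC.nodeBound_notMem_names (R := R) (G := G) (E := E))
  omega

theorem IsCompactTree.transitionColour_spec (hC : IsCompactTree k C)
    (hS : 1 ≤ Fintype.card S) :
    (∃ i, 1 ≤ i ∧ i ∉ names (prune (expand k R G E C)) ∧
      transitionColour k R G E C = 2 * i - 1) ∨
    ∃ P, Green (expand k R G E C) P ∧ transitionColour k R G E C = 2 * lastId P :=
  Nat.sInf_mem (s := {c | ∃ i, 1 ≤ i ∧ i ∉ names (prune (expand k R G E C)) ∧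
    c = 2 * i - 1} ∪ {c | ∃ P, Green (expand k R G E C) P ∧ c = 2 * lastId P})
    ⟨_, Or.inl ⟨nodeBound S k, Nat.mul_pos hS k.succ_pos, hC.nodeBound_notMem_names, rfl⟩⟩

/-- If the nodes named at most `lastId P` all survive a transition, then a branch through `P`
after the transition stems from branches through `P` throughout the transition. -/
theorem IsCompactTree.prefix_of_prefix_nextTree (hC : IsCompactTree k C) {P : List (ℕ × ℕ)}
    (hsurv : ∀ i, 1 ≤ i → i ≤ lastId P → i ∈ names (prune (expand k R G E C)))
    {s' : S} {c' : List (ℕ × ℕ)} (hs' : nextTree k R G E C s' = some c') (hP : P <+: c') :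
    ∃ d, prune (expand k R G E C) s' = some d ∧ P <+: d ∧
      c' = rename (rankIn (names (prune (expand k R G E C)))) d ∧
      rename (rankIn (names (prune (expand k R G E C)))) P = P ∧
      ∃ s c, C s = some c ∧ s' ∈ E s ∧
        expand k R G E C s' = some (advance R G (freshName k s') s' (Finset.Icc 1 k) c) ∧
        P <+: c ∧ ∀ x ∈ P, s' ∉ R x.1 ∧ s' ∉ G x.1 := by
  have hD : IsTree k (prune (expand k R G E C)) := hC.isPretree_expand.isTree_prune
  have hC' : IsCompactTree k (nextTree k R G E C) := hC.isCompactTree_nextTree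
  have hal : Alive (nextTree k R G E C) P := ⟨s', c', hs', hP⟩
  obtain ⟨d, hd, rfl⟩ := Option.map_eq_some_iff.1 hs'
  obtain ⟨P₀, hP₀, hPP₀⟩ := List.prefix_map_iff.1 hP
  have halD : Alive (prune (expand k R G E C)) P₀ := ⟨s', d, hd, hP₀⟩
  have hfix : rename (rankIn (names (prune (expand k R G E C)))) P₀ = P₀ := by
    refine rename_eq_self fun x hx => ?_
    have hxD := halD.mem_names hx
    have hle : rankIn (names (prune (expand k R G E C))) x.2 ≤ lastId P :=
      hC'.le_lastId hal (x := (x.1, rankIn _ x.2)) (by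
        rw [hPP₀]
        exact List.mem_map.2 ⟨x, hx, rfl⟩)
    have h1 := one_le_rankIn hxD
    apply (rankIn_strictMonoOn _).injOn (hsurv _ h1 hle) hxD
    rw [rankIn_eq_self_iff hD.zero_notMem_names]
    exact fun j hj hji => hsurv j hj (hji.trans hle)
  obtain rfl : P = P₀ := hPP₀.trans hfix
  obtain ⟨u, hu, hdu, -⟩ := exists_of_prune_eq_some hd
  obtain ⟨s, c, hs, hE, rfl⟩ := exists_of_expand_eq_some hu
  have hnofresh : ∀ x ∈ P, x.2 ≠ freshName k s' := by
    intro x hx h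
    exact hC'.not_alive_fresh hx h hal
  obtain ⟨h1, h2⟩ := prefix_of_prefix_advance hnofresh (hP₀.trans hdu)
  exact ⟨d, hd, hP₀, rfl, hfix, s, c, hs, hE, hu, h1, h2⟩

end Step

/-! ### Soundness -/

theorem exists_advance_eq_cons {S : Type} {R G : ℕ → Set S} {f j : ℕ} {s : S} {h : Finset ℕ}
    (hj : j ∈ h) (hs : s ∉ R j) {q : List (ℕ × ℕ)} (hq : ∀ x ∈ q.head?, j ≤ x.1) :
    ∃ y b, advance R G f s h q = y :: b ∧ j ≤ y.1 := by
  cases q with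
  | nil => exact ⟨_, _, rfl, le_sup_id hj⟩
  | cons x q =>
    have hx : j ≤ x.1 := hq x rfl
    unfold advance
    split_ifs with h1
    · refine ⟨_, _, rfl, le_nextBelow hj (lt_of_le_of_ne hx ?_)⟩
      rintro rfl
      exact hs h1
    · exact ⟨_, _, rfl, hx⟩
    · exact ⟨_, _, rfl, hx⟩

section Runs

variable {S : Type} [Fintype S] {k : ℕ} {R G : ℕ → Set S} {E : ℕ → S → Set S}
  {C : ℕ → S → Option (List (ℕ × ℕ))}

theorem alive_of_alive_of_le (hC : ∀ t, IsCompactTree k (C t))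
    (hstep : ∀ t, C (t + 1) = nextTree k R G (E t) (C t)) {P : List (ℕ × ℕ)} {T : ℕ}
    (hsurv : ∀ t, T ≤ t → ∀ i, 1 ≤ i → i ≤ lastId P → i ∈ names (prune (expand k R G (E t) (C t))))
    {t : ℕ} (hTt : T ≤ t) (hP : Alive (C t) P) : Alive (C T) P := by
  induction t, hTt using Nat.le_induction with
  | base => exact hP
  | succ t hTt ih =>
    apply ih
    rw [hstep] at hP
    obtain ⟨s', c', hs', hc'⟩ := hP
    obtain ⟨-, -, -, -, -, s, c, hs, -, -, hPc, -⟩ :=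
      (hC t).prefix_of_prefix_nextTree (hsurv t hTt) hs' hc'
    exact ⟨s, c, hs, hPc⟩

/-- An even colour that is eventually minimal and recurs stems from a node that eventually
survives and is green infinitely often. -/
theorem exists_green_of_even_colour (hS : 1 ≤ Fintype.card S) (hC : ∀ t, IsCompactTree k (C t))
    (hstep : ∀ t, C (t + 1) = nextTree k R G (E t) (C t)) {c T : ℕ} (hc : Even c)
    (hio : ∀ N, ∃ t, N ≤ t ∧ transitionColour k R G (E t) (C t) = c)
    (hT : ∀ t, T ≤ t → c ≤ transitionColour k R G (E t) (C t)) :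
    ∃ P, (∀ t, T ≤ t → ∀ i, 1 ≤ i → i ≤ lastId P →
        i ∈ names (prune (expand k R G (E t) (C t)))) ∧
      (∀ t, T ≤ t → Alive (C t) P) ∧
      ∀ N, ∃ t, N ≤ t ∧ Green (expand k R G (E t) (C t)) P := by
  obtain ⟨m, rfl⟩ := hc
  have hsurv : ∀ t, T ≤ t → ∀ i, 1 ≤ i → i ≤ m →
      i ∈ names (prune (expand k R G (E t) (C t))) := by
    intro t ht i hi him
    by_contra hnot
    have h1 := transitionColour_le_of_notMem hi hnot
    have h2 := hT t ht
    omega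
  have hgreen : ∀ t, T ≤ t → transitionColour k R G (E t) (C t) = m + m →
      ∃ P, lastId P = m ∧ Green (expand k R G (E t) (C t)) P ∧ Alive (C t) P := by
    intro t ht hcol
    rcases (hC t).transitionColour_spec (R := R) (G := G) (E := E t) hS with
      ⟨i, hi, -, h⟩ | ⟨P, hP, h⟩
    · omega
    · refine ⟨P, by omega, hP, ?_⟩
      rcases alive_or_of_alive_expand hP.1 with h1 | ⟨s, Q, j, -, hQ, -⟩
      · exact h1
      · have h2 := (hC t).transitionColour_lt (R := R) (G := G) (E := E t) hS
        have h3 := lt_freshName (k := k) s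
        rw [h, hQ, lastId_concat] at h2
        dsimp only at h2
        omega
  obtain ⟨t₀, ht₀, hcol₀⟩ := hio T
  obtain ⟨P, hPm, -, hal₀⟩ := hgreen t₀ ht₀ hcol₀
  subst hPm
  have hrec : ∀ N, ∃ t, N ≤ t ∧ T ≤ t ∧ Green (expand k R G (E t) (C t)) P ∧ Alive (C t) P := by
    intro N
    obtain ⟨t, ht, hcol⟩ := hio (max N T)
    have htT : T ≤ t := (le_max_right N T).trans ht
    obtain ⟨Q, hQ, hgr, hal⟩ := hgreen t htT hcol
    have h1 := alive_of_alive_of_le hC hstep (hQ ▸ hsurv) htT hal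
    have h2 := alive_of_alive_of_le hC hstep hsurv ht₀ hal₀
    rw [(hC T).eq_of_lastId_eq h1 h2 hQ] at hgr hal
    exact ⟨t, (le_max_left N T).trans ht, htT, hgr, hal⟩
  refine ⟨P, hsurv, fun t ht => ?_, fun N => ?_⟩
  · obtain ⟨u, hu, -, -, hal⟩ := hrec t
    exact alive_of_alive_of_le hC hstep (fun v hv => hsurv v (ht.trans hv)) hu hal
  · obtain ⟨t, ht, -, hgr, -⟩ := hrec N
    exact ⟨t, ht, hgr⟩

/-- A run all of whose states are eventually below a node that is green infinitely often. -/
theorem exists_run_of_green (hC : ∀ t, IsCompactTree k (C t))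
    (hstep : ∀ t, C (t + 1) = nextTree k R G (E t) (C t)) {P : List (ℕ × ℕ)} {T : ℕ}
    (hsurv : ∀ t, T ≤ t → ∀ i, 1 ≤ i → i ≤ lastId P →
      i ∈ names (prune (expand k R G (E t) (C t))))
    (hal : ∀ t, T ≤ t → Alive (C t) P) :
    ∃ r : ℕ → S, C 0 (r 0) ≠ none ∧ (∀ t, r (t + 1) ∈ E t (r t)) ∧
      ∀ t, T ≤ t → (∀ x ∈ P, r (t + 1) ∉ R x.1 ∧ r (t + 1) ∉ G x.1) ∧
        ∃ q, C t (r t) = some (P ++ q) ∧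
          expand k R G (E t) (C t) (r (t + 1)) = some (P ++ advance R G (freshName k (r (t + 1)))
            (r (t + 1)) (remaining (Finset.Icc 1 k) P) q) := by
  let X : ℕ → Set S := fun t => {s | ∃ c, C t s = some c ∧ (T ≤ t → P <+: c)}
  let F : ℕ → S → S → Prop := fun t s s' => s' ∈ E t s ∧ (T ≤ t →
    (∀ x ∈ P, s' ∉ R x.1 ∧ s' ∉ G x.1) ∧ ∃ q, C t s = some (P ++ q) ∧
      expand k R G (E t) (C t) s' = some (P ++ advance R G (freshName k s') s'
        (remaining (Finset.Icc 1 k) P) q))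
  have hpred : ∀ t, ∀ s' ∈ X (t + 1), ∃ s ∈ X t, F t s s' := by
    rintro t s' ⟨c', hs', hP⟩
    rw [hstep] at hs'
    by_cases ht : T ≤ t
    · obtain ⟨-, -, -, -, -, s, c, hs, hE, hexp, hPc, hcut⟩ :=
        (hC t).prefix_of_prefix_nextTree (hsurv t ht) hs' (hP (by omega))
      refine ⟨s, ⟨c, hs, fun _ => hPc⟩, hE, fun _ => ⟨hcut, ?_⟩⟩
      obtain ⟨q, rfl⟩ := hPc
      exact ⟨q, hs, by rw [hexp, advance_append hcut]⟩
    · obtain ⟨d, hd, -⟩ := Option.map_eq_some_iff.1 hs'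
      obtain ⟨u, hu, -⟩ := exists_of_prune_eq_some hd
      obtain ⟨s, c, hs, hE, -⟩ := exists_of_expand_eq_some hu
      exact ⟨s, ⟨c, hs, fun h => absurd h ht⟩, hE, fun h => absurd h ht⟩
  have hne : ∀ t, (X t).Nonempty := by
    have hne' : ∀ t, T ≤ t → (X t).Nonempty := by
      intro t ht
      obtain ⟨s, c, hs, hc⟩ := hal t ht
      exact ⟨s, c, hs, fun _ => hc⟩
    have hback : ∀ d t, (X (t + d)).Nonempty → (X t).Nonempty := by
      intro d
      induction d with
      | zero => exact fun t h => h
      | succ d ih =>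
        rintro t ⟨s', hs'⟩
        obtain ⟨s, hs, -⟩ := hpred (t + d) s' hs'
        exact ih t ⟨s, hs⟩
    exact fun t => hback T t (hne' _ (by omega))
  obtain ⟨r, hr⟩ := exists_path_of_levels X F hne hpred
  refine ⟨r, ?_, fun t => (hr t).2.1, fun t ht => (hr t).2.2 ht⟩
  obtain ⟨c, hc, -⟩ := (hr 0).1
  simp [hc]

theorem exists_run_of_even_colour (hS : 1 ≤ Fintype.card S) (hC : ∀ t, IsCompactTree k (C t))
    (hstep : ∀ t, C (t + 1) = nextTree k R G (E t) (C t)) {c T : ℕ} (hc : Even c)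
    (hio : ∀ N, ∃ t, N ≤ t ∧ transitionColour k R G (E t) (C t) = c)
    (hT : ∀ t, T ≤ t → c ≤ transitionColour k R G (E t) (C t)) :
    ∃ r : ℕ → S, C 0 (r 0) ≠ none ∧ (∀ t, r (t + 1) ∈ E t (r t)) ∧
      ∀ j, 1 ≤ j → j ≤ k →
        (∃ N, ∀ t, N ≤ t → r t ∉ G j) ∨ ∀ N, ∃ t, N ≤ t ∧ r t ∈ R j := by
  obtain ⟨P, hsurv, hal, hgreen⟩ := exists_green_of_even_colour hS hC hstep hc hio hT
  obtain ⟨r, hr0, hrE, hr⟩ := exists_run_of_green hC hstep hsurv hal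
  refine ⟨r, hr0, hrE, fun j hj hjk => ?_⟩
  by_cases hdrop : ∃ x ∈ P, x.1 = j
  · obtain ⟨x, hx, rfl⟩ := hdrop
    refine Or.inl ⟨T + 1, fun t ht => ?_⟩
    obtain ⟨u, rfl⟩ := Nat.exists_eq_add_of_le' (show 1 ≤ t by omega)
    exact ((hr u (by omega)).1 x hx).2
  have hrem : j ∈ remaining (Finset.Icc 1 k) P :=
    mem_remaining.2 ⟨Finset.mem_Icc.2 ⟨hj, hjk⟩, by push Not at hdrop; exact hdrop⟩
  right
  by_contra hR
  push Not at hR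
  obtain ⟨N, hN⟩ := hR
  obtain ⟨t₁, ht₁, hg₁⟩ := hgreen (max N T)
  have hinv : ∀ t, t₁ + 1 ≤ t → ∃ q, C t (r t) = some (P ++ q) ∧ ∀ x ∈ q.head?, j ≤ x.1 := by
    intro t ht
    induction t, ht using Nat.le_induction with
    | base =>
      obtain ⟨q, hq, -⟩ := (hr (t₁ + 1) (by omega)).2
      refine ⟨q, hq, ?_⟩
      rw [hstep] at hq
      obtain ⟨d, hd, hPd, hdq, hfix, -⟩ := (hC t₁).prefix_of_prefix_nextTree
        (hsurv t₁ (by omega)) hq (List.prefix_append P q)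
      obtain ⟨-, -, -, hng, -⟩ := exists_of_prune_eq_some hd
      have : P = d := by
        by_contra hne
        exact hng P hPd hne hg₁
      rw [← this, hfix] at hdq
      have : q = [] := by simpa using hdq
      simp [this]
    | succ t ht ih =>
      obtain ⟨q, hq, hexp⟩ := (hr t (by omega)).2
      obtain ⟨q', hq', -⟩ := (hr (t + 1) (by omega)).2
      refine ⟨q', hq', ?_⟩
      obtain ⟨q₀, hq₀, hhead⟩ := ih
      rw [hq, Option.some.injEq, List.append_cancel_left_eq] at hq₀
      subst hq₀
      obtain ⟨y, b, hadv, hy⟩ := exists_advance_eq_cons (G := G) (f := freshName k (r (t + 1)))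
        hrem (hN (t + 1) (by omega)) hhead
      rw [hadv] at hexp
      rw [hstep] at hq'
      obtain ⟨d, hd, ⟨e, rfl⟩, hdq, hfix, -⟩ := (hC t).prefix_of_prefix_nextTree
        (hsurv t (by omega)) hq' (List.prefix_append P q')
      obtain ⟨u, hu, hdu, -⟩ := exists_of_prune_eq_some hd
      rw [hexp, Option.some.injEq] at hu
      subst hu
      rw [rename, List.map_append, ← rename, hfix, List.append_cancel_left_eq] at hdq
      subst hdq
      rw [List.prefix_append_right_inj] at hdu
      cases e with
      | nil => simp
      | cons z e =>
        rw [List.cons_prefix_cons] at hdu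
        simpa [hdu.1] using hy
  obtain ⟨t₂, ht₂, hg₂⟩ := hgreen (t₁ + 1)
  obtain ⟨q, hq, hexp⟩ := (hr t₂ (by omega)).2
  obtain ⟨q₀, hq₀, hhead⟩ := hinv t₂ ht₂
  rw [hq, Option.some.injEq, List.append_cancel_left_eq] at hq₀
  subst hq₀
  obtain ⟨y, b, hadv, hy⟩ := exists_advance_eq_cons (G := G) (f := freshName k (r (t₂ + 1)))
    hrem (hN (t₂ + 1) (by omega)) hhead
  rw [hadv] at hexp
  have := hg₂.2 y ⟨_, _, hexp, by simp⟩
  omega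

end Runs

/-! ### Completeness -/

theorem exists_forall_eq_of_antitone {f : ℕ → ℕ} {T : ℕ} (hf : ∀ t, T ≤ t → f (t + 1) ≤ f t) :
    ∃ T', T ≤ T' ∧ ∀ t, T' ≤ t → f t = f T' := by
  obtain ⟨T', hT', hmin⟩ := exists_minimalFor_of_wellFoundedLT (T ≤ ·) f ⟨T, le_rfl⟩
  refine ⟨T', hT', fun t ht => ?_⟩
  induction t, ht using Nat.le_induction with
  | base => rfl
  | succ t ht ih =>
    have h1 := hf t (hT'.trans ht)
    rw [ih] at h1
    exact le_antisymm h1 (hmin (show T ≤ t + 1 by omega) h1)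

theorem IsTree.lastId_lt {S : Type} {k : ℕ} {C : S → Option (List (ℕ × ℕ))} (hC : IsTree k C)
    {P : List (ℕ × ℕ)} {x : ℕ × ℕ} (h : Alive C (P ++ [x])) : lastId P < x.2 := by
  have h1 := hC.increasing _ h
  have h2 := hC.pos _ h x (by simp)
  rcases List.eq_nil_or_concat P with rfl | ⟨Q, y, rfl⟩
  · exact h2
  · rw [List.concat_eq_append] at *
    rw [lastId_concat]
    exact (List.pairwise_append.1 h1).2.2 y (by simp) x (by simp)

section Runs

variable {S : Type} [Fintype S] {k : ℕ} {R G : ℕ → Set S}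

/-- Below a surviving node that is not green, the branch of a successor continues with a son that
comes no later than the one its own predecessor suggests. -/
theorem IsCompactTree.exists_son {E : S → Set S} {C : S → Option (List (ℕ × ℕ))}
    (hC : IsCompactTree k C) {P q c' : List (ℕ × ℕ)} {s s' : S} (hs : C s = some (P ++ q))
    (hE : s' ∈ E s) (hs' : nextTree k R G E C s' = some c') (hP : P <+: c')
    (hcut : ∀ x ∈ P, s' ∉ R x.1 ∧ s' ∉ G x.1)
    (hsurv : ∀ i, 1 ≤ i → i ≤ lastId P → i ∈ names (prune (expand k R G E C)))
    (hgreen : ¬ Green (expand k R G E C) P) :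
    ∃ (y z : ℕ × ℕ) (b w : List (ℕ × ℕ)),
      c' = P ++ (y.1, rankIn (names (prune (expand k R G E C))) y.2) :: b ∧
      advance R G (freshName k s') s' (remaining (Finset.Icc 1 k) P) q = z :: w ∧
      (y.1 < z.1 ∨ y.1 = z.1 ∧ y.2 ≤ z.2) := by
  have hC' : IsCompactTree k (nextTree k R G E C) := hC.isCompactTree_nextTree
  obtain ⟨d, hd, hPd, rfl, hfix, -⟩ := hC.prefix_of_prefix_nextTree hsurv hs' hP
  obtain ⟨u, hu, hdu, -, hd'⟩ := exists_of_prune_eq_some hd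
  obtain ⟨u', hu', hprec⟩ := exists_expand_eq_some (R := R) (G := G) (k := k) hs hE
  rw [hu, Option.some.injEq] at hu'
  subst hu'
  have hne : P ≠ d := by
    rintro rfl
    rcases hd' with rfl | h
    · obtain ⟨Q, j, rfl, -⟩ := exists_concat_of_expand_eq_some hu
      exact hC'.not_alive_fresh (x := (j, freshName k s')) (by simp) rfl ⟨s', _, hs', hP⟩
    · exact hgreen h
  obtain ⟨e, rfl⟩ := hPd
  obtain ⟨y, b, rfl⟩ : ∃ y b, e = y :: b := List.exists_cons_of_ne_nil (by rintro rfl; simp at hne)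
  obtain ⟨p, j, hadv, -⟩ := advance_eq_concat (R := R) (G := G) (f := freshName k s') (s := s')
    (remaining (Finset.Icc 1 k) P) q
  obtain ⟨z, w, hzw⟩ : ∃ z w, p ++ [(j, freshName k s')] = z :: w :=
    List.exists_cons_of_ne_nil (by simp)
  rw [hzw] at hadv
  refine ⟨y, z, rename (rankIn (names (prune (expand k R G E C)))) b, w, ?_, hadv, ?_⟩
  · conv_lhs => rw [rename, List.map_append, ← rename, hfix]
    rfl
  · obtain ⟨e, rfl⟩ := hdu
    exact hprec P y z (b ++ e) w (by simp) (by rw [advance_append hcut, hadv])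

theorem IsCompactTree.son_le (hR : R 0 = ∅) {E : S → Set S} {C : S → Option (List (ℕ × ℕ))}
    (hC : IsCompactTree k C) {P q q' : List (ℕ × ℕ)} {x x' : ℕ × ℕ} {s s' : S}
    (hs : C s = some (P ++ x :: q)) (hE : s' ∈ E s)
    (hs' : nextTree k R G E C s' = some (P ++ x' :: q'))
    (hcut : ∀ x ∈ P, s' ∉ R x.1 ∧ s' ∉ G x.1)
    (hsurv : ∀ i, 1 ≤ i → i ≤ lastId P → i ∈ names (prune (expand k R G E C)))
    (hgreen : ¬ Green (expand k R G E C) P) :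
    x'.1 ≤ x.1 ∧ (s' ∈ R x.1 → x'.1 < x.1) ∧
      (s' ∉ R x.1 → s' ∉ G x.1 → x'.1 = x.1 → x'.2 ≤ x.2 ∧
        (x'.2 = x.2 → ∀ i, 1 ≤ i → i ≤ x.2 → i ∈ names (prune (expand k R G E C)))) := by
  obtain ⟨y, z, b, w, h1, hadv, hyz⟩ :=
    hC.exists_son hs hE hs' (by simp) hcut hsurv hgreen
  have h0 : 0 ∉ names (prune (expand k R G E C)) :=
    hC.isPretree_expand.isTree_prune.zero_notMem_names
  rw [List.append_cancel_left_eq, List.cons.injEq] at h1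
  obtain ⟨rfl, -⟩ := h1
  have hrank := rankIn_le h0 y.2
  dsimp only
  unfold advance at hadv
  split_ifs at hadv with h2 h3 <;> rw [List.cons.injEq] at hadv <;> obtain ⟨rfl, -⟩ := hadv
  · have hx : 0 < x.1 := by
      rw [Nat.pos_iff_ne_zero]
      intro h
      rw [h, hR] at h2
      exact h2
    have h4 := nextBelow_lt (h := remaining (Finset.Icc 1 k) P) hx
    dsimp only at hyz
    exact ⟨by omega, fun _ => by omega, fun h => absurd h2 h⟩
  · dsimp only at hyz
    exact ⟨by omega, fun h => absurd h h2, fun _ h => absurd h3 h⟩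
  · refine ⟨by omega, fun h => absurd h h2, fun _ _ h => ⟨by omega, fun h' => ?_⟩⟩
    have hx : rankIn (names (prune (expand k R G E C))) y.2 = x.2 := h'
    rw [show x.2 = y.2 by omega] at hx ⊢
    exact (rankIn_eq_self_iff h0 y.2).1 hx

variable {E : ℕ → S → Set S} {C : ℕ → S → Option (List (ℕ × ℕ))}

/-- From time `T` on, the run `r` stays below the node at the end of `P`, which keeps its name. -/
def StableFrom (k : ℕ) (R G : ℕ → Set S) (E : ℕ → S → Set S)
    (C : ℕ → S → Option (List (ℕ × ℕ))) (r : ℕ → S) (P : List (ℕ × ℕ)) (T : ℕ) : Prop :=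
  ∀ t, T ≤ t → (∃ q, C t (r t) = some (P ++ q)) ∧
    (∀ x ∈ P, r (t + 1) ∉ R x.1 ∧ r (t + 1) ∉ G x.1) ∧
    ∀ i, 1 ≤ i → i ≤ lastId P → i ∈ names (prune (expand k R G (E t) (C t)))

theorem exists_stableFrom_concat (hR : R 0 = ∅) (hC : ∀ t, IsCompactTree k (C t))
    (hstep : ∀ t, C (t + 1) = nextTree k R G (E t) (C t)) {r : ℕ → S}
    (hr : ∀ t, r (t + 1) ∈ E t (r t))
    (hacc : ∀ j, (∃ N, ∀ t, N ≤ t → r t ∉ G j) ∨ ∀ N, ∃ t, N ≤ t ∧ r t ∈ R j)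
    {P : List (ℕ × ℕ)} {T : ℕ} (hst : StableFrom k R G E C r P T)
    (hgreen : ∀ t, T ≤ t → ¬ Green (expand k R G (E t) (C t)) P) :
    ∃ x T', StableFrom k R G E C r (P ++ [x]) T' := by
  have hson : ∀ t, ∃ x q, T + 1 ≤ t → C t (r t) = some (P ++ x :: q) := by
    intro t
    by_cases ht : T + 1 ≤ t
    · obtain ⟨t, rfl⟩ := Nat.exists_eq_add_of_le' (show 1 ≤ t by omega)
      obtain ⟨⟨q, hq⟩, hcut, hsurv⟩ := hst t (by omega)
      obtain ⟨⟨q', hq'⟩, -⟩ := hst (t + 1) (by omega)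
      rw [hstep] at hq'
      obtain ⟨y, -, b, -, h, -⟩ := (hC t).exists_son hq (hr t) hq' (by simp) hcut hsurv
        (hgreen t (by omega))
      rw [h, ← hstep] at hq'
      exact ⟨_, _, fun _ => hq'⟩
    · exact ⟨(0, 0), [], fun h => absurd h ht⟩
  choose x q hxq using hson
  have hle := fun t (ht : T + 1 ≤ t) => (hC t).son_le hR (hxq t ht) (hr t)
    ((congrFun (hstep t) _).symm.trans (hxq (t + 1) (by omega))) (hst t (by omega)).2.1
    (hst t (by omega)).2.2 (hgreen t (by omega))
  obtain ⟨T₁, hT₁, hconst₁⟩ :=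
    exists_forall_eq_of_antitone (f := fun t => (x t).1) fun t ht => (hle t ht).1
  have hnR : ∀ t, T₁ ≤ t → r (t + 1) ∉ R (x T₁).1 := by
    intro t ht hmem
    rw [← hconst₁ t ht] at hmem
    have h1 := (hle t (hT₁.trans ht)).2.1 hmem
    have h2 := hconst₁ t ht
    have h3 := hconst₁ (t + 1) (by omega)
    omega
  obtain ⟨N, hN⟩ := (hacc (x T₁).1).resolve_right (fun h => by
    obtain ⟨t, ht, hmem⟩ := h (T₁ + 1)
    obtain ⟨t, rfl⟩ := Nat.exists_eq_add_of_le' (show 1 ≤ t by omega)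
    exact hnR t (by omega) hmem)
  have hle₂ : ∀ t, max T₁ N ≤ t → (x (t + 1)).2 ≤ (x t).2 ∧ ((x (t + 1)).2 = (x t).2 →
      ∀ i, 1 ≤ i → i ≤ (x t).2 → i ∈ names (prune (expand k R G (E t) (C t)))) := by
    intro t ht
    have ht₁ : T₁ ≤ t := (le_max_left _ _).trans ht
    have htN : N ≤ t := (le_max_right _ _).trans ht
    apply (hle t (hT₁.trans ht₁)).2.2
    · rw [hconst₁ t ht₁]
      exact hnR t ht₁
    · rw [hconst₁ t ht₁]
      exact hN (t + 1) (by omega)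
    · rw [hconst₁ t ht₁, hconst₁ (t + 1) (by omega)]
  obtain ⟨T₂, hT₂, hconst₂⟩ :=
    exists_forall_eq_of_antitone (f := fun t => (x t).2) fun t ht => (hle₂ t ht).1
  have ht₁₂ : T₁ ≤ T₂ := (le_max_left _ _).trans hT₂
  have htN : N ≤ T₂ := (le_max_right _ _).trans hT₂
  refine ⟨((x T₁).1, (x T₂).2), T₂, fun t ht => ⟨⟨q t, ?_⟩, ?_, ?_⟩⟩
  · rw [hxq t (by omega), ← hconst₁ t (by omega), ← hconst₂ t ht]
    simp
  · intro y hy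
    rcases List.mem_append.1 hy with hy | hy
    · exact (hst t (by omega)).2.1 y hy
    · rw [List.mem_singleton] at hy
      subst hy
      exact ⟨hnR t (by omega), hN (t + 1) (by omega)⟩
  · rw [lastId_concat, ← hconst₂ t ht]
    exact (hle₂ t (hT₂.trans ht)).2 (by rw [hconst₂ t ht, hconst₂ (t + 1) (by omega)])

/-- An accepting run eventually stays below a node that keeps its name and is green infinitely
often. -/
theorem exists_stableFrom_green (hR : R 0 = ∅) (hC : ∀ t, IsCompactTree k (C t))
    (hstep : ∀ t, C (t + 1) = nextTree k R G (E t) (C t)) {r : ℕ → S}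
    (hr : ∀ t, r (t + 1) ∈ E t (r t)) (h0 : C 0 (r 0) ≠ none)
    (hacc : ∀ j, (∃ N, ∀ t, N ≤ t → r t ∉ G j) ∨ ∀ N, ∃ t, N ≤ t ∧ r t ∈ R j) :
    ∃ P T, StableFrom k R G E C r P T ∧
      ∀ N, ∃ t, N ≤ t ∧ Green (expand k R G (E t) (C t)) P := by
  have hsome : ∀ t, ∃ c, C t (r t) = some c := by
    intro t
    induction t with
    | zero => exact Option.ne_none_iff_exists'.1 h0
    | succ t ih =>
      obtain ⟨c, hc⟩ := ih
      obtain ⟨u, hu, -⟩ := exists_expand_eq_some (k := k) (R := R) (G := G) hc (hr t)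
      obtain ⟨d, hd⟩ := exists_prune_eq_some hu
      exact ⟨_, by rw [hstep, nextTree, hd]; rfl⟩
  suffices h : ∀ m P T, StableFrom k R G E C r P T → nodeBound S k - lastId P = m →
      ∃ P T, StableFrom k R G E C r P T ∧
        ∀ N, ∃ t, N ≤ t ∧ Green (expand k R G (E t) (C t)) P by
    refine h _ [] 0 (fun t _ => ⟨hsome t, by simp, fun i h1 h2 => ?_⟩) rfl
    rw [lastId_nil] at h2
    omega
  intro m
  induction m using Nat.strong_induction_on with
  | _ m ih =>
  intro P T hst hm
  by_cases hgreen : ∀ N, ∃ t, N ≤ t ∧ Green (expand k R G (E t) (C t)) P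
  · exact ⟨P, T, hst, hgreen⟩
  · push Not at hgreen
    obtain ⟨N, hN⟩ := hgreen
    obtain ⟨x, T', hst'⟩ := exists_stableFrom_concat (T := max T N) hR hC hstep hr hacc
      (fun t ht => hst t ((le_max_left _ _).trans ht))
      (fun t ht => hN t ((le_max_right _ _).trans ht))
    obtain ⟨q, hq⟩ := (hst' T' le_rfl).1
    have hal : Alive (C T') (P ++ [x]) := ⟨_, _, hq, List.prefix_append _ _⟩
    have h1 := (hC T').lastId_lt hal
    have h2 := (hC T').lt_of_mem_names (hal.mem_names (x := x) (by simp))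
    refine ih _ ?_ (P ++ [x]) T' hst' rfl
    rw [lastId_concat]
    unfold nodeBound at hm ⊢
    omega

theorem exists_even_colour_of_run (hS : 1 ≤ Fintype.card S) (hR : R 0 = ∅)
    (hC : ∀ t, IsCompactTree k (C t))
    (hstep : ∀ t, C (t + 1) = nextTree k R G (E t) (C t)) {r : ℕ → S}
    (hr : ∀ t, r (t + 1) ∈ E t (r t)) (h0 : C 0 (r 0) ≠ none)
    (hacc : ∀ j, (∃ N, ∀ t, N ≤ t → r t ∉ G j) ∨ ∀ N, ∃ t, N ≤ t ∧ r t ∈ R j) :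
    ∃ c, Even c ∧ (∀ N, ∃ t, N ≤ t ∧ transitionColour k R G (E t) (C t) = c) ∧
      ∃ T, ∀ t, T ≤ t → c ≤ transitionColour k R G (E t) (C t) := by
  classical
  obtain ⟨P, T, hst, hgreen⟩ := exists_stableFrom_green hR hC hstep hr h0 hacc
  have hle : ∃ c, ∀ N, ∃ t, N ≤ t ∧ transitionColour k R G (E t) (C t) ≤ c := by
    refine ⟨2 * lastId P, fun N => ?_⟩
    obtain ⟨t, ht, hg⟩ := hgreen N
    exact ⟨t, ht, transitionColour_le_of_green hg⟩
  obtain ⟨N₀, hN₀⟩ : ∃ N, ∀ t, N ≤ t → Nat.find hle ≤ transitionColour k R G (E t) (C t) := by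
    by_cases hz : Nat.find hle = 0
    · exact ⟨0, fun t _ => by omega⟩
    · have := Nat.find_min hle (m := Nat.find hle - 1) (by omega)
      push Not at this
      obtain ⟨N, hN⟩ := this
      exact ⟨N, fun t ht => by have := hN t ht; omega⟩
  have hio : ∀ N, ∃ t, N ≤ t ∧ transitionColour k R G (E t) (C t) = Nat.find hle := by
    intro N
    obtain ⟨t, ht, h⟩ := Nat.find_spec hle (max N N₀)
    exact ⟨t, (le_max_left _ _).trans ht, le_antisymm h (hN₀ t ((le_max_right _ _).trans ht))⟩
  refine ⟨Nat.find hle, ?_, hio, N₀, hN₀⟩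
  have hbound : Nat.find hle ≤ 2 * lastId P := Nat.find_le fun N => by
    obtain ⟨t, ht, hg⟩ := hgreen N
    exact ⟨t, ht, transitionColour_le_of_green hg⟩
  obtain ⟨t, ht, hcol⟩ := hio T
  rcases (hC t).transitionColour_spec (R := R) (G := G) (E := E t) hS with
    ⟨i, hi, hnot, h⟩ | ⟨Q, -, h⟩
  · exact absurd ((hst t ht).2.2 i hi (by omega)) hnot
  · rw [← hcol, h]
    exact even_two_mul _

end Runs

/-! ### Counting trees -/

section Counting

variable {S : Type} {k : ℕ} {C C' : S → Option (List (ℕ × ℕ))}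

/-- A tree given by the number of its non-root nodes and, for every such node, the name of its
parent and the pair dropped on the edge leading to it. -/
abbrev TreeShape (m k : ℕ) : Type := Σ t : Fin m, ((i : Fin t) → Fin (i + 1) × Fin (k + 1))

/-- The nodes of `C` form a tree of the shape `σ`. -/
def HasShape {m : ℕ} (C : S → Option (List (ℕ × ℕ))) (σ : TreeShape m k) : Prop :=
  (∃ s, C s ≠ none) ∧ (∀ i ∈ names C, i ≤ σ.1) ∧
    ∀ i : Fin σ.1, ∃ (P : List (ℕ × ℕ)) (x : ℕ × ℕ), Alive C (P ++ [x]) ∧ x.2 = i + 1 ∧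
      lastId P = (σ.2 i).1 ∧ x.1 = (σ.2 i).2

theorem IsCompactTree.exists_hasShape [Fintype S] (hC : IsCompactTree k C)
    (hne : ∃ s, C s ≠ none) : ∃ σ : TreeShape (nodeBound S k) k, HasShape C σ := by
  obtain ⟨t, ht⟩ := hC.compact
  have hlt := hC.card_le hne fun i h1 h2 => (ht i).2 ⟨h1, h2⟩
  have hnode : ∀ i : Fin t, ∃ p : Fin (i + 1) × Fin (k + 1),
      ∃ (P : List (ℕ × ℕ)) (x : ℕ × ℕ), Alive C (P ++ [x]) ∧ x.2 = i + 1 ∧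
        lastId P = p.1 ∧ x.1 = p.2 := by
    intro i
    obtain ⟨P, x, hal, hx⟩ := (ht (i + 1)).2 ⟨by omega, by omega⟩
    have h1 := hC.lastId_lt hal
    have h2 := (hC.adm _ hal).fst_mem (x := x) (by simp)
    rw [Finset.mem_Icc] at h2
    exact ⟨(⟨lastId P, by omega⟩, ⟨x.1, by omega⟩), P, x, hal, hx, rfl, rfl⟩
  choose p hp using hnode
  exact ⟨⟨⟨t, hlt⟩, p⟩, hne, fun i hi => ((ht i).1 hi).2, hp⟩

theorem HasShape.alive {m : ℕ} {σ : TreeShape m k} (hC : IsTree k C) (hC' : IsTree k C')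
    (h : HasShape C σ) (h' : HasShape C' σ) {P : List (ℕ × ℕ)} (hP : Alive C P) :
    Alive C' P := by
  induction P using List.reverseRecOn with
  | nil =>
    obtain ⟨s, hs⟩ := h'.1
    obtain ⟨c, hc⟩ := Option.ne_none_iff_exists'.1 hs
    exact ⟨s, c, hc, List.nil_prefix⟩
  | append_singleton P x ih =>
    have hP' := ih (hP.of_prefix (List.prefix_append _ _))
    have h1 := hC.pos _ hP x (by simp)
    have h2 := h.2.1 x.2 (hP.mem_names (by simp))
    let i : Fin σ.1 := ⟨x.2 - 1, by omega⟩
    have hi : (i : ℕ) + 1 = x.2 := Nat.sub_add_cancel h1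
    obtain ⟨P₁, x₁, hal₁, hx₁, hl₁, hj₁⟩ := h.2.2 i
    obtain ⟨P₂, x₂, hal₂, hx₂, hl₂, hj₂⟩ := h'.2.2 i
    have heq := List.append_inj' (hC.unique P₁ x₁ P x hal₁ hP (hx₁.trans hi)) rfl
    rw [List.singleton_inj] at heq
    obtain ⟨rfl, rfl⟩ := heq
    rw [hC'.eq_of_lastId_eq hP' (hal₂.of_prefix (List.prefix_append _ _)) (hl₁.trans hl₂.symm),
      Prod.ext (hj₁.trans hj₂.symm) (hx₁.trans hx₂.symm)]
    exact hal₂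

theorem IsPretree.some_mem_range_iff (hC : IsPretree k C) {c : List (ℕ × ℕ)} :
    some c ∈ Set.range C ↔ Alive C c ∧ ∀ x, ¬ Alive C (c ++ [x]) := by
  constructor
  · rintro ⟨s, hs⟩
    exact ⟨alive_of_eq_some hs, fun x => hC.leaf s c x hs⟩
  · rintro ⟨⟨s, _, hs, q, rfl⟩, hleaf⟩
    cases q with
    | nil => exact ⟨s, by simpa using hs⟩
    | cons x q => exact absurd ⟨s, _, hs, by simp⟩ (hleaf x)

theorem exists_injOn_range (α β : Type*) [Nonempty α] :
    ∃ g : Set β → β → α, ∀ f : α → β, Set.InjOn (g (Set.range f)) (Set.range f) := by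
  have h : ∀ I : Set β, ∃ g : β → α, ∀ f : α → β, Set.range f = I → Set.InjOn g I := by
    intro I
    by_cases hI : ∃ f : α → β, Set.range f = I
    · obtain ⟨f, rfl⟩ := hI
      exact ⟨Function.invFun f, fun _ _ => Set.LeftInvOn.injOn (f₁' := f) fun _ hx =>
        Function.invFun_eq hx⟩
    · exact ⟨fun _ => Classical.arbitrary α, fun f hf => absurd ⟨f, hf⟩ hI⟩
  choose g hg using h
  exact ⟨g, fun f => hg _ f rfl⟩

theorem exists_injective_code (S : Type) [Fintype S] [Nonempty S] (k : ℕ) :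
    ∃ f : {C : S → Option (List (ℕ × ℕ)) // IsCompactTree k C} →
      Option (TreeShape (nodeBound S k) k) × (S → S), Function.Injective f := by
  have hshape : ∀ C : {C : S → Option (List (ℕ × ℕ)) // IsCompactTree k C},
      ∃ o : Option (TreeShape (nodeBound S k) k),
        (o = none → ∀ s, C.1 s = none) ∧ ∀ σ, o = some σ → HasShape C.1 σ := by
    rintro ⟨C, hC⟩
    by_cases hne : ∃ s, C s ≠ none
    · obtain ⟨σ, hσ⟩ := hC.exists_hasShape hne
      refine ⟨some σ, by simp, fun τ hτ => ?_⟩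
      rw [← Option.some.inj hτ]
      exact hσ
    · push Not at hne
      exact ⟨none, fun _ => hne, by simp⟩
  choose o ho using hshape
  obtain ⟨g, hg⟩ := exists_injOn_range S (Option (List (ℕ × ℕ)))
  refine ⟨fun C => (o C, fun s => g (Set.range C.1) (C.1 s)), fun C C' h => Subtype.ext ?_⟩
  rw [Prod.mk.injEq] at h
  obtain ⟨h1, h2⟩ := h
  rcases hoC : o C with _ | σ
  · funext s
    rw [(ho C).1 hoC s, (ho C').1 (h1 ▸ hoC) s]
  have hσ := (ho C).2 σ hoC
  have hσ' := (ho C').2 σ (h1 ▸ hoC)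
  have halive : ∀ P, Alive C.1 P ↔ Alive C'.1 P := fun P =>
    ⟨hσ.alive C.2.toIsTree C'.2.toIsTree hσ', hσ'.alive C'.2.toIsTree C.2.toIsTree hσ⟩
  have hsome : ∀ c, some c ∈ Set.range C.1 ↔ some c ∈ Set.range C'.1 := fun c => by
    simp only [C.2.some_mem_range_iff, C'.2.some_mem_range_iff, halive]
  have hcard : (Set.range C.1).ncard = (Set.range C'.1).ncard := by
    rw [← (hg C.1).ncard_image, ← (hg C'.1).ncard_image,
      ← Set.range_comp, ← Set.range_comp]
    exact congrArg (fun f => (Set.range f).ncard) h2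
  have hrange : Set.range C.1 = Set.range C'.1 := by
    by_cases hnone : none ∈ Set.range C'.1
    · refine Set.eq_of_subset_of_ncard_le ?_ hcard.ge (Set.finite_range _)
      rintro (_ | c) hc
      · exact hnone
      · exact (hsome c).1 hc
    · refine (Set.eq_of_subset_of_ncard_le ?_ hcard.le (Set.finite_range _)).symm
      rintro (_ | c) hc
      · exact absurd hc hnone
      · exact (hsome c).2 hc
  funext s
  apply hg C.1 ⟨s, rfl⟩ (hrange ▸ ⟨s, rfl⟩)
  have := congrFun h2 s
  rwa [← hrange] at this

theorem one_add_sum_factorial_le {c : ℕ} (hc : 2 ≤ c) (p : ℕ) :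
    1 + ∑ t ∈ Finset.range (p + 1), t.factorial * c ^ t ≤ p.factorial * c ^ (p + 1) := by
  induction p with
  | zero => simpa using hc
  | succ p ih =>
    rw [Finset.sum_range_succ, ← add_assoc]
    have h1 : p.factorial * c ^ (p + 1) ≤ (p + 1).factorial * c ^ (p + 1) :=
      Nat.mul_le_mul_right _ (Nat.factorial_le p.le_succ)
    have h2 := Nat.mul_le_mul_left ((p + 1).factorial * c ^ (p + 1)) hc
    rw [pow_succ c (p + 1), ← mul_assoc]
    omega

theorem card_treeShape (m k : ℕ) : Fintype.card (TreeShape m k) =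
    ∑ t ∈ Finset.range m, t.factorial * (k + 1) ^ t := by
  rw [Fintype.card_sigma, ← Fin.sum_univ_eq_sum_range (fun t => t.factorial * (k + 1) ^ t)]
  refine Finset.sum_congr rfl fun t _ => ?_
  rw [Fintype.card_pi]
  simp only [Fintype.card_prod, Fintype.card_fin]
  rw [Finset.prod_mul_distrib, Fin.prod_univ_eq_prod_range (fun i => i + 1),
    Finset.prod_range_add_one_eq_factorial]
  simp

theorem exists_fintype_card_le (S : Type) [Fintype S] [Nonempty S] {k : ℕ} (hk : 1 ≤ k) :
    ∃ inst : Fintype ({C : S → Option (List (ℕ × ℕ)) // IsCompactTree k C} ×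
        Fin (2 * nodeBound S k)),
      @Fintype.card _ inst ≤ 2 * Fintype.card S ^ Fintype.card S * (k + 1) ^ nodeBound S k *
        (nodeBound S k).factorial := by
  classical
  obtain ⟨f, hf⟩ := exists_injective_code S k
  let _ : Fintype {C : S → Option (List (ℕ × ℕ)) // IsCompactTree k C} := Fintype.ofInjective f hf
  refine ⟨inferInstance, ?_⟩
  have h1 := Fintype.card_le_of_injective f hf
  rw [Fintype.card_prod, Fintype.card_option, Fintype.card_fun, card_treeShape] at h1
  obtain ⟨p, hp⟩ := Nat.exists_eq_add_of_le' (show 1 ≤ Fintype.card S * (k + 1) from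
    Nat.mul_pos Fintype.card_pos k.succ_pos)
  have h2 := one_add_sum_factorial_le (c := k + 1) (by omega) p
  rw [Fintype.card_prod, Fintype.card_fin]
  unfold nodeBound at *
  rw [hp] at h1 ⊢
  rw [Nat.factorial_succ]
  calc _ ≤ (p.factorial * (k + 1) ^ (p + 1)) * Fintype.card S ^ Fintype.card S * (2 * (p + 1)) :=
        Nat.mul_le_mul_right _ (h1.trans (Nat.mul_le_mul_right _ (by omega)))
    _ = _ := by ring

end Counting

/-! ### The deterministic parity automaton -/

theorem exists_dpw_of_one_le {A : Type} {S : Type} [Fintype S] {k : ℕ} (hk : 1 ≤ k)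
    (δ : S → A → Set S) (s0 : S) (R G : Fin k → Set S) :
    ∃ (T : Type) (instT : Fintype T) (δ' : T → A → T) (t0 : T)
      (F : Fin (2 * (Fintype.card S * (k + 1))) → Set T),
      @Fintype.card T instT ≤ 2 * Fintype.card S ^ Fintype.card S *
        (k + 1) ^ (Fintype.card S * (k + 1)) * (Fintype.card S * (k + 1)).factorial ∧
      IsPartition F ∧
      {w : ℕ → A | ParityAccept F (DetRun δ' t0 w)} = StreettLang δ s0 R G := by
  classical
  have _ : Nonempty S := ⟨s0⟩
  have hS : 1 ≤ Fintype.card S := Fintype.card_pos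
  let pairSet : (Fin k → Set S) → ℕ → Set S := fun Q j =>
    {s | ∃ i : Fin k, (i : ℕ) + 1 = j ∧ s ∈ Q i}
  have hpair0 : ∀ Q, pairSet Q 0 = ∅ := by
    intro Q
    refine Set.eq_empty_of_forall_notMem ?_
    rintro s ⟨i, hi, -⟩
    omega
  have hpair : ∀ Q (i : Fin k) s, s ∈ pairSet Q (i + 1) ↔ s ∈ Q i := by
    intro Q i s
    constructor
    · rintro ⟨i', hi, hs⟩
      rwa [show i = i' from Fin.ext (by omega)]
    · exact fun hs => ⟨i, rfl, hs⟩
  obtain ⟨inst, hcard⟩ := exists_fintype_card_le S hk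
  let T : Type := {C : S → Option (List (ℕ × ℕ)) // IsCompactTree k C} × Fin (2 * nodeBound S k)
  let δ' : T → A → T := fun x a =>
    (⟨nextTree k (pairSet R) (pairSet G) (δ · a) x.1.1, x.1.2.isCompactTree_nextTree⟩,
      ⟨transitionColour k (pairSet R) (pairSet G) (δ · a) x.1.1, x.1.2.transitionColour_lt hS⟩)
  let t0 : T := (⟨_, isCompactTree_single k s0⟩,
    ⟨0, Nat.mul_pos two_pos (Nat.mul_pos hS k.succ_pos)⟩)
  refine ⟨T, inst, δ', t0, fun c => {x | x.2 = c}, hcard, isPartition_fibres _, ?_⟩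
  ext w
  let C : ℕ → S → Option (List (ℕ × ℕ)) := fun t => (DetRun δ' t0 w t).1.1
  let E : ℕ → S → Set S := fun t s => δ s (w t)
  have hC : ∀ t, IsCompactTree k (C t) := fun t => (DetRun δ' t0 w t).1.2
  have hstep : ∀ t, C (t + 1) = nextTree k (pairSet R) (pairSet G) (E t) (C t) := fun t => rfl
  have hcol : ∀ t, ((DetRun δ' t0 w (t + 1)).2 : ℕ) =
      transitionColour k (pairSet R) (pairSet G) (E t) (C t) := fun t => rfl
  have hC0 : ∀ s, C 0 s ≠ none ↔ s = s0 := fun s => by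
    change (if s = s0 then some ([] : List (ℕ × ℕ)) else none) ≠ none ↔ s = s0
    simp
  rw [Set.mem_ofPred_eq, parityAccept_fibres_iff]
  constructor
  · rintro ⟨c, hc, hio, N, hN⟩
    obtain ⟨r, hr0, hr, hacc⟩ := exists_run_of_even_colour hS hC hstep hc (T := N)
      (fun M => by
        obtain ⟨t, ht, h⟩ := hio (M + 1)
        obtain ⟨t, rfl⟩ := Nat.exists_eq_add_of_le' (show 1 ≤ t by omega)
        exact ⟨t, by omega, h⟩)
      (fun t ht => hN (t + 1) (by omega))
    refine ⟨r, ⟨(hC0 _).1 hr0, hr⟩, fun i => ?_⟩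
    rw [infOcc_inter_eq_empty_iff, infOcc_inter_nonempty_iff]
    simpa only [hpair] using hacc (i + 1) (by omega) (by omega)
  · rintro ⟨r, ⟨hr0, hr⟩, hacc⟩
    obtain ⟨c, hc, hio, N, hN⟩ := exists_even_colour_of_run hS (hpair0 R) hC hstep hr
      ((hC0 _).2 hr0) (G := pairSet G) (fun j => by
        by_cases hj : 1 ≤ j ∧ j ≤ k
        · obtain ⟨i, rfl⟩ : ∃ i : Fin k, (i : ℕ) + 1 = j := ⟨⟨j - 1, by omega⟩, by simp; omega⟩
          have := hacc i
          rw [infOcc_inter_eq_empty_iff, infOcc_inter_nonempty_iff] at this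
          simpa only [hpair] using this
        · left
          refine ⟨0, ?_⟩
          rintro t - ⟨i, hi, -⟩
          omega)
    refine ⟨c, hc, fun M => ?_, N + 1, fun t ht => ?_⟩
    · obtain ⟨t, ht, h⟩ := hio M
      exact ⟨t + 1, by omega, h⟩
    · obtain ⟨t, rfl⟩ := Nat.exists_eq_add_of_le' (show 1 ≤ t by omega)
      exact hN t (by omega)

/-- For every nondeterministic Streett word automaton `S` with
`n ≥ 1` states and `k` pairs there exists a deterministic parity word automaton
`D` with at most `2·n^n·(k+1)^{n(k+1)}·(n(k+1))!` states and parity index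
`2n(k+1)` such that `L(D) = L(S)`. -/
theorem nsw_to_dpw (A : Type) [Fintype A] (S : Type) [Fintype S] (n k : ℕ)
    (hn : 1 ≤ n) (hcard : Fintype.card S = n)
    (δ : S → A → Set S) (s0 : S) (R G : Fin k → Set S) :
    ∃ (T : Type) (instT : Fintype T) (δ' : T → A → T) (t0 : T)
      (F : Fin (2 * (n * (k + 1))) → Set T),
      @Fintype.card T instT ≤
        2 * n ^ n * (k + 1) ^ (n * (k + 1)) * (n * (k + 1)).factorial ∧
      IsPartition F ∧
      {w : ℕ → A | ParityAccept F (DetRun δ' t0 w)} = StreettLang δ s0 R G := by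
  subst hcard
  rcases Nat.eq_zero_or_pos k with rfl | hk
  · exact streett_zero_pairs hn δ s0 R G
  · exact exists_dpw_of_one_le hk δ s0 R G
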